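/- Let p ≥ 10^20 be prime, let e be an even divisor of p−1, let p_1, …, p_s be the distinct primes dividing p−1 but not dividing e (with s = 0 and δ = 1 if there are none, and otherwise δ = 1 − Σ_{i=1}^{s} 1/p_i), assume δ > 0, and let N, H be integers with 1 ≤ H ≤ 2·p^{5/8}. Then N_{p−1}(H) ≥ δ · (φ(e)/e) · ( H − W(e) · 3.5751 · H^{1/2} · p^{3/16} · (log p)^{1/4} · ((s−1)/δ + 2) ), where W(e) = 2^{ω(e)}. -/

import Mathlib

/-- An integer `x` (indivisible by `p`) is `e`-free if for every divisor `d > 1` of `e`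
the congruence `x ≡ y ^ d (mod p)` has no solution `y`. -/
def IsEFree (p e : ℕ) (x : ℤ) : Prop :=
  ¬ (p : ℤ) ∣ x ∧ ∀ d : ℕ, d ∣ e → 1 < d → ¬ ∃ y : ℤ, Int.ModEq p x (y ^ d)

/-- `NcountEFree p e N H` is the number of integers `x` with `N + 1 ≤ x ≤ N + H` that are
indivisible by `p` and `e`-free. -/
noncomputable def NcountEFree (p e : ℕ) (N H : ℤ) : ℕ :=
  {x : ℤ | N + 1 ≤ x ∧ x ≤ N + H ∧ IsEFree p e x}.ncard

section Stepanov

open Polynomial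

lemma exists_nontrivial_combination_eq_zero {F ι : Type*} [Field F] [Fintype ι] (r : ι → F[X])
    (D : ℕ) (hr : ∀ i, (r i).natDegree < D) (hD : D < Fintype.card ι) :
    ∃ γ : ι → F, γ ≠ 0 ∧ ∑ i, C (γ i) * r i = 0 := by
  let φ : (ι → F) →ₗ[F] (Fin D → F) :=
    (LinearMap.pi fun n : Fin D => lcoeff F (n : ℕ)) ∘ₗ Fintype.linearCombination F r
  have hker : LinearMap.ker φ ≠ ⊥ := by
    apply LinearMap.ker_ne_bot_of_finrank_lt
    simpa using hD
  obtain ⟨γ, hγ, hγ0⟩ := (Submodule.ne_bot_iff _).1 hker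
  refine ⟨γ, hγ0, ?_⟩
  ext n
  rcases lt_or_ge n D with hn | hn
  · have := congrFun (LinearMap.mem_ker.1 hγ) ⟨n, hn⟩
    simpa [φ, Fintype.linearCombination_apply, smul_eq_C_mul] using this
  · rw [coeff_eq_zero_of_natDegree_lt, coeff_zero]
    refine lt_of_lt_of_le ?_ hn
    have hD0 : 0 < D := by
      obtain ⟨i, -⟩ := Function.ne_iff.1 hγ0
      exact (Nat.zero_le _).trans_lt (hr i)
    refine lt_of_le_of_lt (natDegree_sum_le_of_forall_le (n := D - 1) _ _ ?_) (by omega)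
    intro i _
    have := hr i
    exact (natDegree_C_mul_le _ _).trans (by omega)

lemma sum_ne_zero_of_injective_natDegree {F ι : Type*} [Field F] [Fintype ι] (r : ι → F[X])
    (hr0 : ∀ i, r i ≠ 0) (hr : Function.Injective fun i => (r i).natDegree)
    (γ : ι → F) (hγ : γ ≠ 0) : ∑ i, C (γ i) * r i ≠ 0 := by
  obtain ⟨j, hj⟩ := Function.ne_iff.1 hγ
  intro h
  have hdeg := degree_sum_eq_of_disjoint (fun i => C (γ i) * r i) Finset.univ (by
    rintro a ⟨-, ha⟩ b ⟨-, hb⟩ hab hd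
    have ha' : γ a ≠ 0 := by rintro h; simp [h] at ha
    have hb' : γ b ≠ 0 := by rintro h; simp [h] at hb
    apply hab
    apply hr
    simp only [Function.comp, degree_C_mul ha', degree_C_mul hb'] at hd
    exact natDegree_eq_of_degree_eq hd)
  rw [h, degree_zero] at hdeg
  have h1 := Finset.le_sup (f := fun i => (C (γ i) * r i).degree) (Finset.mem_univ j)
  rw [← hdeg, le_bot_iff, degree_C_mul (by simpa using hj), degree_eq_bot] at h1
  exact hr0 j h1

lemma stepanov_exponents_injective {m d t I K : ℕ} (hmd : m.Coprime d)
    (hI : I + m ≤ t) :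
    Function.Injective fun a : Fin I × Fin K × Fin d =>
      ((a.1 : ℕ) + (a.2.1 : ℕ) * (d * t + 1)) + (a.2.2 : ℕ) * (t * m) := by
  rintro ⟨⟨i, hi⟩, ⟨k, hk⟩, ⟨l, hl⟩⟩ ⟨⟨i', hi'⟩, ⟨k', hk'⟩, ⟨l', hl'⟩⟩ h
  simp only at h
  have hd : 0 < d := by omega
  have key : ((d * t + 1 : ℕ) : ℤ) * (d * ((k : ℤ) - k') + m * ((l : ℤ) - l')) =
      d * ((i' : ℤ) - i) + m * ((l : ℤ) - l') := by
    have h' : ((i : ℤ) + k * (d * t + 1)) + l * (t * m) =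
      (i' + k' * (d * t + 1)) + l' * (t * m) := by exact_mod_cast h
    push_cast
    linear_combination (d : ℤ) * h'
  have hbound : |(d : ℤ) * ((i' : ℤ) - i) + m * ((l : ℤ) - l')| < ((d * t + 1 : ℕ) : ℤ) := by
    have h1 : |(i' : ℤ) - i| ≤ I - 1 := by rw [abs_le]; omega
    have h2 : |(l : ℤ) - l'| ≤ d - 1 := by rw [abs_le]; omega
    calc |(d : ℤ) * ((i' : ℤ) - i) + m * ((l : ℤ) - l')|
        ≤ d * |(i' : ℤ) - i| + m * |(l : ℤ) - l'| := by
          refine (abs_add_le _ _).trans ?_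
          simp [abs_mul]
      _ ≤ d * (I - 1) + m * (d - 1) := by gcongr
      _ < ((d * t + 1 : ℕ) : ℤ) := by
          have : (I : ℤ) + m ≤ t := by exact_mod_cast hI
          push_cast
          nlinarith
  have hz : (d : ℤ) * ((k : ℤ) - k') + m * ((l : ℤ) - l') = 0 := by
    by_contra hne
    rw [← key, abs_mul, abs_of_nonneg (by positivity)] at hbound
    have : (1 : ℤ) ≤ |(d : ℤ) * ((k : ℤ) - k') + m * ((l : ℤ) - l')| := Int.one_le_abs hne
    nlinarith [Int.natCast_nonneg (d * t + 1)]
  rw [hz, mul_zero] at key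
  have hdl : (d : ℤ) ∣ (l : ℤ) - l' := by
    have h1 : (d : ℤ) ∣ m * ((l : ℤ) - l') := ⟨-((k : ℤ) - k'), by linear_combination hz⟩
    exact (IsCoprime.dvd_of_dvd_mul_left (Nat.isCoprime_iff_coprime.2 hmd.symm) h1)
  have hll : (l : ℤ) - l' = 0 := by
    apply Int.eq_zero_of_abs_lt_dvd hdl
    rw [abs_lt]; omega
  rw [hll] at hz key
  have hd' : (d : ℤ) ≠ 0 := by exact_mod_cast hd.ne'
  have h1 : (k : ℤ) - k' = 0 := (mul_eq_zero.1 (by simpa using hz)).resolve_left hd'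
  have h2 : (i' : ℤ) - i = 0 := (mul_eq_zero.1 (by simpa using key.symm)).resolve_left hd'
  simp only [Prod.mk.injEq, Fin.mk.injEq]
  omega

/-- Stepanov's bound for the fibres of `x ↦ f x ^ ((q - 1) / d)` over a field with `q = Q ^ 2`
elements. -/
lemma stepanov_fiber_bound {F : Type*} [Field F] [Fintype F] (p k : ℕ) [Fact p.Prime] [CharP F p]
    (hF : Fintype.card F = (p ^ k) ^ 2) {d t m : ℕ} (hd : 0 < d) (hQ : p ^ k = d * t + 1)
    {f : F[X]} (hf : f.natDegree = m) (hf0 : f ≠ 0) (hmd : m.Coprime d)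
    (ht : d * m * (m + 3) + m + 4 ≤ t) {ζ : F} (hζ : ζ ≠ 0) (E : Finset F)
    (hE : ∀ x ∈ E, f.eval x ^ (t * (p ^ k + 1)) = ζ) :
    d * E.card ≤ (p ^ k) ^ 2 + (d * (2 * m + 3) + 1) * p ^ k := by
  set Q := p ^ k with hQdef
  obtain ⟨I, hI⟩ : ∃ I, t = I + m := ⟨t - m, by omega⟩
  set K := t + m + 3 with hK
  set g := f ^ t with hg
  have hg0 : g ≠ 0 := pow_ne_zero _ hf0
  have hgdeg : g.natDegree = t * m := by rw [hg, natDegree_pow, hf]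
  have hgE : ∀ x ∈ E, g.eval x ^ Q * g.eval x = ζ := by
    intro x hx
    rw [← hE x hx, hg, eval_pow]; ring
  have hFrob : ∀ y : F, (y ^ Q) ^ Q = y := by
    intro y
    rw [← pow_mul, ← sq, ← hF, FiniteField.pow_card]
  obtain ⟨γ, hγ0, hγ⟩ := exists_nontrivial_combination_eq_zero
    (fun a : Fin I × Fin K × Fin d => C (ζ ^ (a.2.2 : ℕ)) *
      (X ^ ((a.1 : ℕ) * Q + (a.2.1 : ℕ)) * g ^ (d - 1 - (a.2.2 : ℕ))))
    (I * Q + K + d * (t * m)) (by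
      rintro ⟨⟨i, hi⟩, ⟨k, hk⟩, ⟨l, hl⟩⟩
      refine (natDegree_C_mul_le _ _).trans_lt (natDegree_mul_le.trans_lt ?_)
      rw [natDegree_X_pow, natDegree_pow, hgdeg]
      simp only
      have h1 : i * Q ≤ I * Q := Nat.mul_le_mul_right _ hi.le
      have h2 : (d - 1 - l) * (t * m) ≤ d * (t * m) := Nat.mul_le_mul_right _ (by omega)
      omega) (by
      simp only [Fintype.card_prod, Fintype.card_fin]
      rw [hQ, hK]
      have h1 : d * (t * m) = d * (I * m) + d * m * m := by rw [hI]; ring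
      have h2 : 1 ≤ d := hd
      have h3 : d * m * (m + 3) + 4 ≤ I := by omega
      have h4 : I ≤ d * I := Nat.le_mul_of_pos_left _ hd
      nlinarith)
  set P : F[X] := ∑ a : Fin I × Fin K × Fin d,
    C ((fun a => γ a ^ Q) a) * (X ^ ((a.1 : ℕ) + (a.2.1 : ℕ) * Q) * g ^ (a.2.2 : ℕ)) with hP
  have hdeg : ∀ a : Fin I × Fin K × Fin d,
      (X ^ ((a.1 : ℕ) + (a.2.1 : ℕ) * Q) * g ^ (a.2.2 : ℕ)).natDegree =
      ((a.1 : ℕ) + (a.2.1 : ℕ) * Q) + (a.2.2 : ℕ) * (t * m) := by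
    intro a
    rw [natDegree_mul (pow_ne_zero _ X_ne_zero) (pow_ne_zero _ hg0), natDegree_X_pow,
      natDegree_pow, hgdeg]
  have hP0 : P ≠ 0 := by
    apply sum_ne_zero_of_injective_natDegree
    · intro a
      exact mul_ne_zero (pow_ne_zero _ X_ne_zero) (pow_ne_zero _ hg0)
    · simp only [hdeg]
      rw [hQ]
      exact stepanov_exponents_injective hmd (by omega)
    · intro h
      apply hγ0
      funext a
      have := congrFun h a
      simpa using eq_zero_of_pow_eq_zero this
  have hroots : E.val ⊆ P.roots := by
    intro x hx
    rw [mem_roots hP0, IsRoot.def]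
    have hx' : x ∈ E := hx
    have hgx : g.eval x ≠ 0 := by
      intro h
      apply hζ
      rw [← hgE x hx', h, mul_zero]
    have h1 : (P.eval x) ^ Q * g.eval x ^ (d - 1) = 0 := by
      have h2 := congrArg (eval x) hγ
      rw [eval_zero, eval_finsetSum] at h2
      rw [← h2, hP, eval_finsetSum, hQdef, sum_pow_char_pow p k, Finset.sum_mul]
      refine Finset.sum_congr rfl ?_
      rintro ⟨⟨i, hi⟩, ⟨j, hj⟩, ⟨l, hl⟩⟩ -
      simp only [eval_mul, eval_C, eval_pow, eval_X]
      rw [← hQdef, mul_pow, hFrob, mul_pow, ← hgE x hx', mul_pow (eval x g ^ Q)]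
      have e1 : (x ^ (i + j * Q)) ^ Q = x ^ (i * Q + j) := by
        rw [pow_add, mul_pow, pow_add, ← pow_mul, pow_mul x j Q, hFrob]
      have e2 : eval x g ^ (d - 1) = eval x g ^ l * eval x g ^ (d - 1 - l) := by
        rw [← pow_add]; congr 1; omega
      rw [e1, e2]
      ring
    simpa [hgx, show Q ≠ 0 by omega] using h1
  have hcard := card_le_degree_of_subset_roots hroots
  have hPdeg : P.natDegree ≤ I + K * Q + d * (t * m) := by
    refine natDegree_sum_le_of_forall_le _ _ ?_
    rintro ⟨⟨i, hi⟩, ⟨j, hj⟩, ⟨l, hl⟩⟩ -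
    refine (natDegree_C_mul_le _ _).trans ?_
    rw [hdeg]
    simp only
    have h1 : j * Q ≤ K * Q := Nat.mul_le_mul_right _ hj.le
    have h2 : l * (t * m) ≤ d * (t * m) := Nat.mul_le_mul_right _ hl.le
    omega
  have hE2 : E.card ≤ I + K * Q + d * (t * m) := hcard.trans hPdeg
  calc d * E.card ≤ d * (I + K * Q + d * (t * m)) := Nat.mul_le_mul_left _ hE2
    _ ≤ Q ^ 2 + (d * (2 * m + 3) + 1) * Q := by
      have h1 : d * t ≤ Q := by omega
      have h2 : d * I ≤ Q := by nlinarith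
      have h3 : d * (K * Q) = (d * t) * Q + d * (m + 3) * Q := by rw [hK]; ring
      have h4 : d * (d * (t * m)) ≤ d * m * Q := by nlinarith [Nat.zero_le (d * m)]
      nlinarith

end Stepanov

noncomputable instance galoisFieldFintype (p n : ℕ) [Fact p.Prime] : Fintype (GaloisField p n) :=
  Fintype.ofFinite _

section EulerProduct

open Polynomial UniqueFactorizationMonoid

variable (p : ℕ) [Fact p.Prime]

lemma finite_setOf_monic_natDegree_eq (n : ℕ) :
    {g : (ZMod p)[X] | g.Monic ∧ g.natDegree = n}.Finite := by
  have : Finite (degreeLT (ZMod p) (n + 1)) :=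
    Finite.of_equiv _ (degreeLTEquiv (ZMod p) (n + 1)).symm.toEquiv
  refine Set.Finite.subset (Set.toFinite (degreeLT (ZMod p) (n + 1) : Set (ZMod p)[X])) ?_
  rintro g ⟨-, hg⟩
  simp only [SetLike.mem_coe, mem_degreeLT]
  exact degree_le_natDegree.trans_lt (by rw [hg]; exact_mod_cast Nat.lt_succ_self n)

/-- The monic polynomials of degree `n` over `ZMod p`. -/
noncomputable def monicsOfDegree (n : ℕ) : Finset (ZMod p)[X] :=
  (finite_setOf_monic_natDegree_eq p n).toFinset

variable {p}

lemma mem_monicsOfDegree {n : ℕ} {g : (ZMod p)[X]} :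
    g ∈ monicsOfDegree p n ↔ g.Monic ∧ g.natDegree = n := by
  simp [monicsOfDegree]

/-- The characteristic polynomial over `ZMod p` of an element of `GaloisField p k`, written as a
power of its minimal polynomial. -/
noncomputable def galoisCharpoly {k : ℕ} (x : GaloisField p k) : (ZMod p)[X] :=
  minpoly (ZMod p) x ^ (k / (minpoly (ZMod p) x).natDegree)

lemma natDegree_minpoly_dvd {k : ℕ} (hk : k ≠ 0) (x : GaloisField p k) :
    (minpoly (ZMod p) x).natDegree ∣ k := by
  have := minpoly.degree_dvd (Algebra.IsIntegral.isIntegral (R := ZMod p) x)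
  rwa [GaloisField.finrank p hk] at this

lemma galoisCharpoly_mem_monicsOfDegree {k : ℕ} (hk : k ≠ 0) (x : GaloisField p k) :
    galoisCharpoly x ∈ monicsOfDegree p k := by
  have hint := Algebra.IsIntegral.isIntegral (R := ZMod p) x
  rw [mem_monicsOfDegree, galoisCharpoly]
  refine ⟨(minpoly.monic hint).pow _, ?_⟩
  rw [natDegree_pow, Nat.div_mul_cancel (natDegree_minpoly_dvd hk x)]

open Classical in
lemma card_filter_minpoly_eq {k : ℕ} (hk : k ≠ 0) {π : (ZMod p)[X]} (hπ : Irreducible π)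
    (hm : π.Monic) :
    (Finset.univ.filter fun x : GaloisField p k => minpoly (ZMod p) x = π).card =
      if π.natDegree ∣ k then π.natDegree else 0 := by
  split_ifs with h
  · have : Fact (Irreducible π) := ⟨hπ⟩
    have hfin : Module.finrank (ZMod p) (AdjoinRoot π) = π.natDegree :=
      finrank_quotient_span_eq_natDegree
    have h1 := FiniteField.natCard_algHom_of_finrank_dvd (F := ZMod p) (K := AdjoinRoot π)
      (L := GaloisField p k) (by rw [hfin, GaloisField.finrank p hk]; exact h)
    rw [hfin, Nat.card_congr (AdjoinRoot.equiv (GaloisField p k) (ZMod p) π hπ.ne_zero)] at h1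
    rw [← h1, ← Fintype.card_subtype, ← Nat.card_eq_fintype_card]
    refine Nat.card_congr (Equiv.subtypeEquivRight fun x => ?_)
    rw [mem_aroots]
    constructor
    · rintro rfl
      exact ⟨hπ.ne_zero, minpoly.aeval _ _⟩
    · rintro ⟨-, hx⟩
      exact (minpoly.eq_of_irreducible_of_monic hπ hx hm).symm
  · rw [Finset.card_eq_zero, Finset.filter_eq_empty_iff]
    rintro x - rfl
    exact h (natDegree_minpoly_dvd hk x)

open Classical in
lemma card_filter_galoisCharpoly_dvd {k : ℕ} (hk : k ≠ 0) {g : (ZMod p)[X]} (hg : g.Monic) :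
    (Finset.univ.filter fun x : GaloisField p k => galoisCharpoly x ∣ g).card =
      ∑ π ∈ (normalizedFactors g).toFinset,
        if π.natDegree ∣ k ∧ k / π.natDegree ≤ (normalizedFactors g).count π
          then π.natDegree else 0 := by
  rw [Finset.card_eq_sum_card_fiberwise (f := fun x => minpoly (ZMod p) x)
    (t := (normalizedFactors g).toFinset)]
  · refine Finset.sum_congr rfl fun π hπ => ?_
    rw [Multiset.mem_toFinset] at hπ
    have hirr := irreducible_of_normalized_factor _ hπ
    have hnorm := normalize_normalized_factor _ hπ
    have hmon : π.Monic := by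
      rw [← hnorm]; exact monic_normalize hirr.ne_zero
    rw [Finset.filter_filter]
    have hiff : ∀ x : GaloisField p k, (galoisCharpoly x ∣ g ∧ minpoly (ZMod p) x = π) ↔
        (minpoly (ZMod p) x = π ∧ k / π.natDegree ≤ (normalizedFactors g).count π) := by
      intro x
      rw [and_comm]
      refine and_congr_right fun hx => ?_
      rw [galoisCharpoly, hx, dvd_iff_normalizedFactors_le_normalizedFactors
        (pow_ne_zero _ hirr.ne_zero) hg.ne_zero, normalizedFactors_pow,
        normalizedFactors_irreducible hirr, hnorm, Multiset.le_count_iff_replicate_le,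
        Multiset.nsmul_singleton]
    simp_rw [hiff]
    by_cases hc : k / π.natDegree ≤ (normalizedFactors g).count π
    · simp only [hc, and_true]
      exact card_filter_minpoly_eq hk hirr hmon
    · simp [hc]
  · intro x hx
    simp only [Finset.coe_filter, Finset.mem_univ, true_and, Set.mem_ofPred_eq] at hx
    have hint := Algebra.IsIntegral.isIntegral (R := ZMod p) x
    have hdvd : minpoly (ZMod p) x ∣ g := by
      refine (dvd_pow_self _ ?_).trans hx
      have h1 := Nat.le_of_dvd (Nat.pos_of_ne_zero hk) (natDegree_minpoly_dvd hk x)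
      exact (Nat.div_pos h1 (minpoly.natDegree_pos hint)).ne'
    simp only [Finset.mem_coe, Multiset.mem_toFinset]
    obtain ⟨q, hq, hassoc⟩ :=
      exists_mem_normalizedFactors_of_dvd hg.ne_zero (minpoly.irreducible hint) hdvd
    have : minpoly (ZMod p) x = q := by
      rw [← normalize_normalized_factor _ hq, ← (minpoly.monic hint).normalize_eq_self]
      exact normalize_eq_normalize_iff_associated.2 hassoc
    rwa [this]

lemma card_filter_multiples {n d v : ℕ} (hd : 0 < d) (h : d * v ≤ n) :
    ((Finset.Icc 1 n).filter fun k => d ∣ k ∧ k / d ≤ v).card = v := by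
  have : (Finset.Icc 1 n).filter (fun k => d ∣ k ∧ k / d ≤ v) = (Finset.Icc 1 v).image (d * ·) := by
    ext k
    simp only [Finset.mem_filter, Finset.mem_Icc, Finset.mem_image]
    constructor
    · rintro ⟨⟨h1, h2⟩, ⟨j, rfl⟩, h3⟩
      rw [Nat.mul_div_cancel_left _ hd] at h3
      exact ⟨j, ⟨Nat.pos_of_mul_pos_left h1, h3⟩, rfl⟩
    · rintro ⟨j, ⟨h1, h2⟩, rfl⟩
      refine ⟨⟨Nat.mul_pos hd h1, (Nat.mul_le_mul_left _ h2).trans h⟩, dvd_mul_right _ _, ?_⟩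
      rwa [Nat.mul_div_cancel_left _ hd]
  rw [this, Finset.card_image_of_injective _ (fun a b hab => Nat.eq_of_mul_eq_mul_left hd hab)]
  simp

open Classical in
lemma natDegree_eq_sum_card_galoisCharpoly_dvd {n : ℕ} {g : (ZMod p)[X]}
    (hg : g ∈ monicsOfDegree p n) :
    n = ∑ k ∈ Finset.Icc 1 n,
      (Finset.univ.filter fun x : GaloisField p k => galoisCharpoly x ∣ g).card := by
  obtain ⟨hm, hn⟩ := mem_monicsOfDegree.1 hg
  have hirr : ∀ π ∈ normalizedFactors g, Irreducible π :=
    fun π hπ => irreducible_of_normalized_factor _ hπ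
  have hmon : ∀ π ∈ normalizedFactors g, π.Monic := fun π hπ => by
    rw [← normalize_normalized_factor _ hπ]; exact monic_normalize (hirr π hπ).ne_zero
  have hsum : n = ∑ π ∈ (normalizedFactors g).toFinset,
      (normalizedFactors g).count π * π.natDegree := by
    conv_lhs => rw [← hn, ← hm.normalize_eq_self, ← prod_normalizedFactors_eq hm.ne_zero,
      natDegree_multiset_prod_of_monic _ hmon, Finset.sum_multiset_map_count]
    simp
  rw [Finset.sum_congr rfl fun k hk => card_filter_galoisCharpoly_dvd
    (by have := (Finset.mem_Icc.1 hk).1; omega) hm, Finset.sum_comm]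
  conv_lhs => rw [hsum]
  refine Finset.sum_congr rfl fun π hπ => ?_
  have hle : π.natDegree * (normalizedFactors g).count π ≤ n := by
    rw [mul_comm]
    conv_rhs => rw [hsum]
    exact Finset.single_le_sum (f := fun π => (normalizedFactors g).count π * π.natDegree)
      (fun _ _ => Nat.zero_le _) hπ
  rw [← Finset.sum_filter, Finset.sum_const, smul_eq_mul, card_filter_multiples
    (hirr π (Multiset.mem_toFinset.1 hπ)).natDegree_pos hle]

/-- The logarithmic derivative of the Euler product attached to a completely multiplicative
function on monic polynomials. -/
lemma euler_product_log_deriv (w : (ZMod p)[X] →* ℂ) (n : ℕ) :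
    (n : ℂ) * ∑ g ∈ monicsOfDegree p n, w g =
      ∑ k ∈ Finset.Icc 1 n, (∑ x : GaloisField p k, w (galoisCharpoly x)) *
        ∑ h ∈ monicsOfDegree p (n - k), w h := by
  classical
  have h1 : (n : ℂ) * ∑ g ∈ monicsOfDegree p n, w g = ∑ g ∈ monicsOfDegree p n,
      ∑ k ∈ Finset.Icc 1 n, ∑ x : GaloisField p k, if galoisCharpoly x ∣ g then w g else 0 := by
    rw [Finset.mul_sum]
    refine Finset.sum_congr rfl fun g hg => ?_
    conv_lhs => rw [natDegree_eq_sum_card_galoisCharpoly_dvd hg]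
    push_cast
    rw [Finset.sum_mul]
    refine Finset.sum_congr rfl fun k _ => ?_
    rw [← Finset.sum_filter, Finset.sum_const, nsmul_eq_mul]
  rw [h1, Finset.sum_comm]
  refine Finset.sum_congr rfl fun k hk => ?_
  rw [Finset.mem_Icc] at hk
  rw [Finset.sum_comm, Finset.sum_mul]
  refine Finset.sum_congr rfl fun x _ => ?_
  obtain ⟨hπm, hπd⟩ := mem_monicsOfDegree.1 (galoisCharpoly_mem_monicsOfDegree (by omega) x)
  rw [← Finset.sum_filter, Finset.mul_sum]
  symm
  refine Finset.sum_bij (fun h _ => galoisCharpoly x * h) ?_ ?_ ?_ ?_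
  · intro h hh
    obtain ⟨hm, hd⟩ := mem_monicsOfDegree.1 hh
    rw [Finset.mem_filter, mem_monicsOfDegree, hπm.natDegree_mul hm, hπd, hd]
    exact ⟨⟨hπm.mul hm, by omega⟩, dvd_mul_right _ _⟩
  · intro a _ b _ hab
    exact mul_left_cancel₀ hπm.ne_zero hab
  · intro g hg
    rw [Finset.mem_filter, mem_monicsOfDegree] at hg
    obtain ⟨⟨hm, hd⟩, ⟨h, rfl⟩⟩ := hg
    have hhm := hπm.of_mul_monic_left hm
    rw [hπm.natDegree_mul hhm, hπd] at hd
    exact ⟨h, mem_monicsOfDegree.2 ⟨hhm, by omega⟩, rfl⟩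
  · intro h _
    rw [map_mul]

end EulerProduct

section PowerSums

/-- If the power sums `u ^ k + v ^ k` are `O(P ^ k)`, then `u` and `v` have modulus at most `P`. -/
lemma norm_le_of_norm_pow_add_pow_le {u v : ℂ} {P C : ℝ} {k₀ : ℕ} (hP : 0 < P)
    (h : ∀ k ≥ k₀, ‖u ^ k + v ^ k‖ ≤ C * P ^ k) : ‖u‖ ≤ P := by
  have hC : 0 ≤ C := by
    have h1 := (norm_nonneg _).trans (h k₀ le_rfl)
    exact nonneg_of_mul_nonneg_left h1 (by positivity)
  set D := C + 2 * C + C ^ 2 with hD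
  have key : ∀ k ≥ k₀, ‖u‖ ^ k ≤ (D + 1) * P ^ k := by
    intro k hk
    have h1 := h k hk
    have h2 := h (2 * k) (by omega)
    have hdiff : ‖u ^ k - v ^ k‖ ^ 2 ≤ (2 * C + C ^ 2) * (P ^ k) ^ 2 := by
      have e : (u ^ k - v ^ k) ^ 2 =
          2 * (u ^ (2 * k) + v ^ (2 * k)) - (u ^ k + v ^ k) ^ 2 := by
        rw [mul_comm 2 k, pow_mul, pow_mul]; ring
      rw [← norm_pow, e]
      refine (norm_sub_le _ _).trans ?_
      rw [norm_mul, norm_pow]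
      have e2 : P ^ (2 * k) = (P ^ k) ^ 2 := by rw [mul_comm, pow_mul]
      rw [e2] at h2
      have h3 : ‖u ^ k + v ^ k‖ ^ 2 ≤ (C * P ^ k) ^ 2 := by gcongr
      norm_num
      nlinarith
    have hdiff' : ‖u ^ k - v ^ k‖ ≤ (1 + (2 * C + C ^ 2)) * P ^ k := by
      have hPk : 0 < P ^ k := by positivity
      apply (pow_le_pow_iff_left₀ (norm_nonneg _) (by positivity) two_ne_zero).1
      refine hdiff.trans ?_
      rw [mul_pow]
      gcongr
      nlinarith [sq_nonneg (2 * C + C ^ 2), sq_nonneg C]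
    have e : 2 * u ^ k = (u ^ k + v ^ k) + (u ^ k - v ^ k) := by ring
    have h4 : 2 * ‖u‖ ^ k ≤ C * P ^ k + (1 + (2 * C + C ^ 2)) * P ^ k := by
      have : 2 * ‖u‖ ^ k = ‖2 * u ^ k‖ := by simp
      rw [this, e]
      exact (norm_add_le _ _).trans (add_le_add h1 hdiff')
    have hPk : 0 < P ^ k := by positivity
    have hD0 : 0 ≤ D := by positivity
    rw [hD]
    nlinarith [norm_nonneg u, mul_nonneg hD0 hPk.le]
  by_contra hlt
  push Not at hlt
  have h1 : 1 < ‖u‖ / P := by rwa [one_lt_div hP]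
  obtain ⟨n, hn⟩ := pow_unbounded_of_one_lt (D + 1) h1
  have h2 : (‖u‖ / P) ^ n ≤ (‖u‖ / P) ^ (max n k₀) := pow_le_pow_right₀ h1.le (le_max_left _ _)
  have h3 := key (max n k₀) (le_max_right _ _)
  rw [div_pow, div_pow, ← div_pow] at h2
  have h4 : ‖u‖ ^ (max n k₀) / P ^ (max n k₀) ≤ D + 1 := by
    rw [div_le_iff₀ (by positivity)]; exact h3
  linarith

/-- A sequence obeying Newton's identities for `1 + c₁ T + c₂ T ^ 2` whose even terms are
`O(P ^ k)` satisfies `‖c₁‖ ≤ 2 √P`. -/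
lemma norm_le_two_sqrt_of_newton {c₁ c₂ : ℂ} {S : ℕ → ℂ} (h1 : S 1 = c₁)
    (h2 : 2 * c₂ = S 1 * c₁ + S 2) (h3 : ∀ n ≥ 3, S n + S (n - 1) * c₁ + S (n - 2) * c₂ = 0)
    {P C : ℝ} {k₀ : ℕ} (hP : 0 < P) (hS : ∀ k ≥ k₀, ‖S (2 * k)‖ ≤ C * P ^ k) :
    ‖c₁‖ ≤ 2 * √P := by
  obtain ⟨s, hs⟩ := IsAlgClosed.exists_pow_nat_eq (c₁ ^ 2 - 4 * c₂) (n := 2) (by norm_num)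
  set u := (-c₁ + s) / 2 with hu
  set v := (-c₁ - s) / 2 with hv
  have huv : u + v = -c₁ := by rw [hu, hv]; ring
  have huv2 : u * v = c₂ := by rw [hu, hv]; linear_combination (-1 / 4 : ℂ) * hs
  have hu2 : u ^ 2 + c₁ * u + c₂ = 0 := by linear_combination -huv2 + u * huv
  have hv2 : v ^ 2 + c₁ * v + c₂ = 0 := by linear_combination -huv2 + v * huv
  have hsum : ∀ n, S (n + 1) = -(u ^ (n + 1) + v ^ (n + 1)) := by
    intro n
    induction n using Nat.twoStepInduction with
    | zero => rw [h1]; linear_combination -huv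
    | one => 
      rw [h1] at h2
      linear_combination -h2 + hu2 + hv2 - c₁ * huv
    | more n ih1 ih2 =>
      have h := h3 (n + 1 + 1 + 1) (by omega)
      simp only [Nat.add_sub_cancel, show n + 1 + 1 + 1 - 2 = n + 1 by omega] at h
      rw [ih2, ih1] at h
      linear_combination h + u ^ (n + 1) * hu2 + v ^ (n + 1) * hv2
  have hpow : ∀ k ≥ k₀ + 1, ‖(u ^ 2) ^ k + (v ^ 2) ^ k‖ ≤ C * P ^ k := by
    intro k hk
    have h := hS k (by omega)
    obtain ⟨j, rfl⟩ : ∃ j, k = j + 1 := ⟨k - 1, by omega⟩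
    rw [show 2 * (j + 1) = (2 * j + 1) + 1 by ring, hsum, norm_neg] at h
    rwa [← pow_mul, ← pow_mul]
  have hu' : ‖u‖ ≤ √P := Real.le_sqrt_of_sq_le (by
    rw [← norm_pow]; exact norm_le_of_norm_pow_add_pow_le hP hpow)
  have hv' : ‖v‖ ≤ √P := Real.le_sqrt_of_sq_le (by
    rw [← norm_pow]
    exact norm_le_of_norm_pow_add_pow_le hP (u := v ^ 2) (v := u ^ 2) (C := C) (k₀ := k₀ + 1)
      (fun k hk => by rw [add_comm]; exact hpow k hk))
  have : c₁ = -(u + v) := by rw [huv, neg_neg]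
  rw [this, norm_neg]
  exact (norm_add_le _ _).trans (by linarith)

end PowerSums

section TripleCharacter

open Polynomial

variable {p : ℕ} [Fact p.Prime]

lemma eval_galoisCharpoly {k : ℕ} (hk : k ≠ 0) (x : GaloisField p k) (r : ZMod p) :
    (galoisCharpoly x).eval r = Algebra.norm (ZMod p) (algebraMap (ZMod p) (GaloisField p k) r - x) := by
  have hint := Algebra.IsIntegral.isIntegral (R := ZMod p) x
  set z := x - algebraMap (ZMod p) (GaloisField p k) r with hz
  have hintz := Algebra.IsIntegral.isIntegral (R := ZMod p) z
  have hmin : minpoly (ZMod p) z = (minpoly (ZMod p) x).comp (X + C r) := minpoly.sub_algebraMap x r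
  have hdeg : (minpoly (ZMod p) z).natDegree = (minpoly (ZMod p) x).natDegree := by
    rw [hmin, natDegree_comp]; simp
  have hnorm : Algebra.norm (ZMod p) z =
      ((-1) ^ (minpoly (ZMod p) z).natDegree * (minpoly (ZMod p) x).eval r) ^
        (k / (minpoly (ZMod p) x).natDegree) := by
    rw [Algebra.norm_eq_norm_adjoin]
    have h1 := Algebra.PowerBasis.norm_gen_eq_coeff_zero_minpoly
      (IntermediateField.adjoin.powerBasis hintz)
    rw [IntermediateField.adjoin.powerBasis_gen, IntermediateField.adjoin.powerBasis_dim,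
      IntermediateField.minpoly_gen] at h1
    rw [h1]
    have h2 : (minpoly (ZMod p) z).coeff 0 = (minpoly (ZMod p) x).eval r := by
      rw [coeff_zero_eq_eval_zero, hmin, eval_comp]; simp
    rw [h2]
    congr 1
    have h3 := Module.finrank_mul_finrank (ZMod p) (IntermediateField.adjoin (ZMod p) {z}) (GaloisField p k)
    rw [IntermediateField.adjoin.finrank hintz, GaloisField.finrank p hk, hdeg] at h3
    exact Nat.eq_div_of_mul_eq_right (minpoly.natDegree_pos hint).ne' h3
  have hneg : algebraMap (ZMod p) (GaloisField p k) r - x =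
      algebraMap (ZMod p) (GaloisField p k) (-1) * z := by
    rw [hz, map_neg, map_one]; ring
  rw [hneg, map_mul, Algebra.norm_algebraMap, GaloisField.finrank p hk, hnorm, galoisCharpoly,
    eval_pow, mul_pow, ← pow_mul, hdeg, Nat.mul_div_cancel' (natDegree_minpoly_dvd hk x),
    ← mul_assoc, ← mul_pow]
  simp

/-- The multiplicative function `g ↦ χ (g r₁) χ (g r₂) χ⁻¹ (g r₃)` on polynomials. -/
noncomputable def tripleChar (χ : MulChar (ZMod p) ℂ) (r₁ r₂ r₃ : ZMod p) : (ZMod p)[X] →* ℂ where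
  toFun g := χ (g.eval r₁) * χ (g.eval r₂) * χ⁻¹ (g.eval r₃)
  map_one' := by simp
  map_mul' a b := by simp only [eval_mul, map_mul]; ring

lemma tripleChar_apply (χ : MulChar (ZMod p) ℂ) (r₁ r₂ r₃ : ZMod p) (g : (ZMod p)[X]) :
    tripleChar χ r₁ r₂ r₃ g = χ (g.eval r₁) * χ (g.eval r₂) * χ⁻¹ (g.eval r₃) := rfl

lemma exists_unit_apply_ne_one {χ : MulChar (ZMod p) ℂ} (hχ : χ ≠ 1) :
    ∃ a : ZMod p, a ≠ 0 ∧ χ a ≠ 1 := by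
  obtain ⟨a, ha⟩ := MulChar.ne_one_iff.1 hχ
  exact ⟨a, a.ne_zero, ha⟩

lemma sum_tripleChar_eq_zero {χ : MulChar (ZMod p) ℂ} (hχ : χ ≠ 1) (r₁ r₂ r₃ : ZMod p) {n : ℕ}
    (hn : 3 ≤ n) : ∑ g ∈ monicsOfDegree p n, tripleChar χ r₁ r₂ r₃ g = 0 := by
  obtain ⟨a, ha0, ha⟩ := exists_unit_apply_ne_one hχ
  set M : (ZMod p)[X] := (X - C r₁) * (X - C r₂) * (X - C r₃) with hM
  have hMm : M.Monic := ((monic_X_sub_C _).mul (monic_X_sub_C _)).mul (monic_X_sub_C _)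
  have hMd : M.natDegree = 3 := by
    rw [hM, ((monic_X_sub_C _).mul (monic_X_sub_C _)).natDegree_mul (monic_X_sub_C _),
      (monic_X_sub_C _).natDegree_mul (monic_X_sub_C _)]
    simp
  have hM1 : M ≠ 1 := by
    rintro h; rw [h] at hMd; simp at hMd
  have hdecomp : ∀ (g : (ZMod p)[X]) (b : ZMod p), M * (g /ₘ M) + C b * (g %ₘ M) = g + C (b - 1) * (g %ₘ M) := by
    intro g b
    conv_rhs => rw [← modByMonic_add_div g M]
    rw [add_modByMonic, C_sub, C_1]
    have h1 : (M * (g /ₘ M)) %ₘ M = 0 := by rw [mul_comm]; exact mul_self_modByMonic hMm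
    have h2 : (g %ₘ M) %ₘ M = g %ₘ M := (modByMonic_eq_self_iff hMm).2 (degree_modByMonic_lt _ hMm)
    rw [h1, h2]; ring
  have hmod : ∀ (g : (ZMod p)[X]) (b : ZMod p),
      (M * (g /ₘ M) + C b * (g %ₘ M)) %ₘ M = C b * (g %ₘ M) ∧
      (M * (g /ₘ M) + C b * (g %ₘ M)) /ₘ M = g /ₘ M := by
    intro g b
    have h := div_modByMonic_unique (f := M * (g /ₘ M) + C b * (g %ₘ M)) (g := M) (g /ₘ M)
      (C b * (g %ₘ M)) hMm ⟨by ring, by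
        refine lt_of_le_of_lt ?_ (degree_modByMonic_lt g hMm)
        rw [← smul_eq_C_mul]
        exact degree_smul_le _ _⟩
    exact ⟨h.2, h.1⟩
  have hmem : ∀ (b : ZMod p), ∀ g ∈ monicsOfDegree p n,
      M * (g /ₘ M) + C b * (g %ₘ M) ∈ monicsOfDegree p n := by
    intro b g hg
    obtain ⟨hgm, hgd⟩ := mem_monicsOfDegree.1 hg
    have hlt : (C (b - 1) * (g %ₘ M)).degree < g.degree := by
      rw [← smul_eq_C_mul]
      refine (degree_smul_le _ _).trans_lt ((degree_modByMonic_lt g hMm).trans_le ?_)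
      rw [degree_eq_natDegree hMm.ne_zero, degree_eq_natDegree hgm.ne_zero, hMd, hgd]
      exact_mod_cast hn
    rw [hdecomp, mem_monicsOfDegree]
    exact ⟨hgm.add_of_left hlt, by rw [natDegree_add_eq_left_of_degree_lt hlt, hgd]⟩
  have heval : ∀ (g : (ZMod p)[X]) (b r : ZMod p), M.eval r = 0 →
      (M * (g /ₘ M) + C b * (g %ₘ M)).eval r = b * g.eval r := by
    intro g b r hr
    conv_rhs => rw [← modByMonic_add_div g M]
    simp [hr]
  have hr1 : M.eval r₁ = 0 := by simp [hM]
  have hr2 : M.eval r₂ = 0 := by simp [hM]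
  have hr3 : M.eval r₃ = 0 := by simp [hM]
  have hscale : ∑ g ∈ monicsOfDegree p n, tripleChar χ r₁ r₂ r₃ g =
      χ a * ∑ g ∈ monicsOfDegree p n, tripleChar χ r₁ r₂ r₃ g := by
    rw [Finset.mul_sum]
    symm
    refine Finset.sum_nbij' (fun g => M * (g /ₘ M) + C a * (g %ₘ M))
      (fun g => M * (g /ₘ M) + C a⁻¹ * (g %ₘ M)) (hmem a) (hmem a⁻¹) ?_ ?_ ?_
    · intro g _
      simp only [hmod]
      rw [← mul_assoc, ← C_mul, inv_mul_cancel₀ ha0, C_1, one_mul, add_comm, modByMonic_add_div]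
    · intro g _
      simp only [hmod]
      rw [← mul_assoc, ← C_mul, mul_inv_cancel₀ ha0, C_1, one_mul, add_comm, modByMonic_add_div]
    · intro g _
      rw [tripleChar_apply, tripleChar_apply, heval _ _ _ hr1, heval _ _ _ hr2, heval _ _ _ hr3,
        map_mul, map_mul, map_mul]
      have : χ a * χ⁻¹ a = 1 := by
        rw [← MulChar.mul_apply, mul_inv_cancel, MulChar.one_apply ha0.isUnit]
      linear_combination (-χ a * χ (eval r₁ g) * χ (eval r₂ g) * χ⁻¹ (eval r₃ g)) * this
  have : (χ a - 1) * ∑ g ∈ monicsOfDegree p n, tripleChar χ r₁ r₂ r₃ g = 0 := by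
    linear_combination -hscale
  exact (mul_eq_zero.1 this).resolve_left (sub_ne_zero.2 ha)

lemma sum_monicsOfDegree_zero (w : (ZMod p)[X] →* ℂ) : ∑ g ∈ monicsOfDegree p 0, w g = 1 := by
  have : monicsOfDegree p 0 = {1} := by
    ext g
    rw [mem_monicsOfDegree, Finset.mem_singleton]
    constructor
    · rintro ⟨h1, h2⟩; exact h1.natDegree_eq_zero.1 h2
    · rintro rfl; simp
  rw [this, Finset.sum_singleton, map_one]

lemma sum_monicsOfDegree_one (w : (ZMod p)[X] →* ℂ) :
    ∑ g ∈ monicsOfDegree p 1, w g = ∑ t : ZMod p, w (X - C t) := by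
  symm
  refine Finset.sum_bij (fun t _ => X - C t) ?_ ?_ ?_ ?_
  · intro t _
    exact mem_monicsOfDegree.2 ⟨monic_X_sub_C t, natDegree_X_sub_C t⟩
  · intro a _ b _ h
    simpa using h
  · intro g hg
    obtain ⟨hm, hd⟩ := mem_monicsOfDegree.1 hg
    refine ⟨-g.coeff 0, Finset.mem_univ _, ?_⟩
    conv_rhs => rw [hm.eq_X_add_C hd]
    simp
  · intros; rfl

end TripleCharacter

section Weil

open Polynomial

variable {p : ℕ} [Fact p.Prime]

lemma orderOf_mulChar_dvd (χ : MulChar (ZMod p) ℂ) : orderOf χ ∣ p - 1 := by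
  rw [← ZMod.card_units p]
  exact orderOf_dvd_of_pow_eq_one χ.pow_card_eq_one

lemma pow_eq_pow_of_mulChar_eq {χ : MulChar (ZMod p) ℂ} {u v : ZMod p} (hu : u ≠ 0) (hv : v ≠ 0)
    (h : χ u = χ v) : u ^ ((p - 1) / orderOf χ) = v ^ ((p - 1) / orderOf χ) := by
  obtain ⟨g, hg⟩ := IsCyclic.exists_generator (α := (ZMod p)ˣ)
  obtain ⟨j, hj⟩ := (mem_powers_iff_mem_zpowers.2 (hg (Units.mk0 u hu / Units.mk0 v hv)) :)
  simp only at hj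
  have hw : χ ((g ^ j : (ZMod p)ˣ) : ZMod p) = 1 := by
    rw [hj]
    have h1 : χ (((Units.mk0 u hu / Units.mk0 v hv : (ZMod p)ˣ) : ZMod p) * v) = χ u := by
      congr 1
      simp [hv]
    rw [map_mul, h] at h1
    have h2 : χ v ≠ 0 := (hv.isUnit.map χ).ne_zero
    exact mul_right_cancel₀ h2 (by rw [h1, one_mul])
  rw [Units.val_pow_eq_pow_val, map_pow] at hw
  have hpow : χ ^ j = 1 := by
    rw [MulChar.eq_one_iff]
    intro a
    obtain ⟨i, rfl⟩ := (mem_powers_iff_mem_zpowers.2 (hg a) :)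
    rw [MulChar.pow_apply_coe]
    simp only [Units.val_pow_eq_pow_val, map_pow]
    rw [← pow_mul, mul_comm, pow_mul, hw, one_pow]
  obtain ⟨i, rfl⟩ := orderOf_dvd_of_pow_eq_one hpow
  have h1 : (g ^ (orderOf χ * i)) ^ ((p - 1) / orderOf χ) = 1 := by
    rw [← pow_mul, mul_right_comm, Nat.mul_div_cancel' (orderOf_mulChar_dvd χ), ← ZMod.card_units p,
      pow_mul, pow_card_eq_one, one_pow]
  rw [hj, div_pow, div_eq_one] at h1
  simpa using congrArg Units.val h1

lemma norm_sum_mulChar_norm_le {χ : MulChar (ZMod p) ℂ} (hχ : χ ≠ 1) {k m : ℕ} (hk : k ≠ 0)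
    {f : (GaloisField p (2 * k))[X]} (hf : f.natDegree = m) (hf0 : f ≠ 0)
    (hmd : m.Coprime (orderOf χ))
    (hbig : orderOf χ * (orderOf χ * m * (m + 3) + m + 4) < p ^ k) :
    ‖∑ x, χ (Algebra.norm (ZMod p) (f.eval x))‖ ≤
      ((orderOf χ * (2 * m + 3) + 1 : ℕ) + m : ℝ) * p ^ k := by
  classical
  set d := orderOf χ with hd
  have hdpos : 0 < d := χ.orderOf_pos
  have hd2 : 1 < d := by
    have : d ≠ 1 := fun h => hχ (orderOf_eq_one_iff.1 h)
    omega
  have hp1 : 0 < p - 1 := by have := (Fact.out : p.Prime).two_le; omega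
  have hdvdQ : p - 1 ∣ p ^ k - 1 := by
    simpa using Nat.sub_dvd_pow_sub_pow p 1 k
  obtain ⟨t, ht⟩ : d ∣ p ^ k - 1 := (orderOf_mulChar_dvd χ).trans hdvdQ
  have hQpos : 0 < p ^ k := pow_pos (Fact.out : p.Prime).pos _
  have hQ : p ^ k = d * t + 1 := by omega
  have htbig : d * m * (m + 3) + m + 4 ≤ t := by
    rw [hQ] at hbig
    have : d * (d * m * (m + 3) + m + 4) ≤ d * t := by omega
    exact Nat.le_of_mul_le_mul_left this hdpos
  have hcard : Fintype.card (GaloisField p (2 * k)) = (p ^ k) ^ 2 := by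
    rw [← Nat.card_eq_fintype_card, GaloisField.card p (2 * k) (by omega), ← pow_mul, mul_comm]
  have hexp : ((p ^ k) ^ 2 - 1) / (p - 1) * ((p - 1) / d) = t * (p ^ k + 1) := by
    have h1 : p - 1 ∣ (p ^ k) ^ 2 - 1 := by
      rw [← pow_mul]; simpa using Nat.sub_dvd_pow_sub_pow p 1 (k * 2)
    have h2 : (p ^ k) ^ 2 - 1 = d * (t * (p ^ k + 1)) := by
      rw [hQ]
      have : (d * t + 1) ^ 2 = d * (t * (d * t + 1 + 1)) + 1 := by ring
      omega
    apply Nat.eq_of_mul_eq_mul_left hdpos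
    rw [← h2, mul_left_comm, Nat.mul_div_cancel' (orderOf_mulChar_dvd χ), Nat.div_mul_cancel h1]
  have hnorm : ∀ y : GaloisField p (2 * k),
      y ^ (t * (p ^ k + 1)) = algebraMap (ZMod p) _ (Algebra.norm (ZMod p) y ^ ((p - 1) / d)) := by
    intro y
    rw [map_pow, FiniteField.algebraMap_norm_eq_pow, ← pow_mul, Nat.card_eq_fintype_card,
      Nat.card_eq_fintype_card, hcard, ZMod.card, hexp]
  have hfib : ∀ η : ℂ, η ≠ 0 → d * (Finset.univ.filter fun x : GaloisField p (2 * k) =>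
      χ (Algebra.norm (ZMod p) (f.eval x)) = η).card ≤
        (p ^ k) ^ 2 + (d * (2 * m + 3) + 1) * p ^ k := by
    intro η hη
    have hne : ∀ x : GaloisField p (2 * k), χ (Algebra.norm (ZMod p) (f.eval x)) = η →
        Algebra.norm (ZMod p) (f.eval x) ≠ 0 := by
      intro x hx h0
      rw [h0, MulChar.map_zero] at hx
      exact hη hx.symm
    by_cases hE : ∃ x₀ : GaloisField p (2 * k), χ (Algebra.norm (ZMod p) (f.eval x₀)) = η
    · obtain ⟨x₀, hx₀⟩ := hE
      refine stepanov_fiber_bound p k hcard hdpos hQ hf hf0 hmd htbig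
        (ζ := f.eval x₀ ^ (t * (p ^ k + 1))) ?_ _ ?_
      · apply pow_ne_zero
        intro h0
        exact hne x₀ hx₀ (by rw [h0]; exact Algebra.norm_zero)
      · intro x hx
        have hx' := (Finset.mem_filter.1 hx).2
        rw [hnorm, hnorm, pow_eq_pow_of_mulChar_eq (hne x hx') (hne x₀ hx₀) (hx'.trans hx₀.symm)]
    · push Not at hE
      rw [Finset.filter_false_of_mem (fun x _ => hE x)]
      simp
  have : NeZero d := ⟨hdpos.ne'⟩
  obtain ⟨ζ, hζ⟩ : ∃ ζ : ℂ, IsPrimitiveRoot ζ d := ⟨_, Complex.isPrimitiveRoot_exp d hdpos.ne'⟩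
  set a : ℕ → ℝ := fun i => ((p ^ k) ^ 2 + (d * (2 * m + 3) + 1 : ℕ) * p ^ k : ℝ) / d -
    (Finset.univ.filter fun x : GaloisField p (2 * k) =>
      χ (Algebra.norm (ZMod p) (f.eval x)) = ζ ^ i).card with ha
  have ha0 : ∀ i, 0 ≤ a i := by
    intro i
    have h1 := hfib (ζ ^ i) (pow_ne_zero _ (hζ.ne_zero hdpos.ne'))
    rw [ha]
    simp only [sub_nonneg]
    rw [le_div_iff₀ (by exact_mod_cast hdpos), mul_comm]
    exact_mod_cast h1
  set R : Finset ℂ := (Finset.range d).image (ζ ^ ·) with hR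
  have hinj : Set.InjOn (ζ ^ ·) (Finset.range d : Set ℕ) := by
    intro i hi j hj hij
    exact hζ.pow_inj (Finset.mem_range.1 hi) (Finset.mem_range.1 hj) hij
  set Z := Finset.univ.filter fun x : GaloisField p (2 * k) => f.eval x ≠ 0 with hZ
  have hmaps : ∀ x ∈ Z, χ (Algebra.norm (ZMod p) (f.eval x)) ∈ R := by
    intro x hx
    have hx' := (Finset.mem_filter.1 hx).2
    have hn : Algebra.norm (ZMod p) (f.eval x) ≠ 0 := by
      rwa [Algebra.norm_ne_zero_iff]
    have h1 : χ (Algebra.norm (ZMod p) (f.eval x)) ^ d = 1 := by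
      rw [← MulChar.pow_apply' _ hdpos.ne', hd, pow_orderOf_eq_one, MulChar.one_apply hn.isUnit]
    obtain ⟨i, hi, h2⟩ := hζ.eq_pow_of_pow_eq_one h1
    exact Finset.mem_image.2 ⟨i, Finset.mem_range.2 hi, h2⟩
  have hfilter : ∀ η ∈ R, (Z.filter fun x => χ (Algebra.norm (ZMod p) (f.eval x)) = η) =
      Finset.univ.filter fun x : GaloisField p (2 * k) =>
        χ (Algebra.norm (ZMod p) (f.eval x)) = η := by
    intro η hη
    obtain ⟨i, -, rfl⟩ := Finset.mem_image.1 hη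
    ext x
    simp only [hZ, Finset.mem_filter, Finset.mem_univ, true_and, and_iff_right_iff_imp]
    intro h h0
    rw [h0, Algebra.norm_zero, MulChar.map_zero] at h
    exact pow_ne_zero _ (hζ.ne_zero hdpos.ne') h.symm
  have hsum : ∑ x, χ (Algebra.norm (ZMod p) (f.eval x)) =
      ∑ i ∈ Finset.range d, ((Finset.univ.filter fun x : GaloisField p (2 * k) =>
        χ (Algebra.norm (ZMod p) (f.eval x)) = ζ ^ i).card : ℂ) * ζ ^ i := by
    have h1 : ∑ x, χ (Algebra.norm (ZMod p) (f.eval x)) =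
        ∑ x ∈ Z, χ (Algebra.norm (ZMod p) (f.eval x)) := by
      rw [hZ, Finset.sum_filter_of_ne]
      intro x _ hx h0
      rw [h0, Algebra.norm_zero, MulChar.map_zero] at hx
      exact hx rfl
    rw [h1, ← Finset.sum_fiberwise_of_maps_to hmaps,
      ← Finset.sum_image (g := (ζ ^ ·)) (f := fun η => ((Finset.univ.filter
        fun x : GaloisField p (2 * k) =>
        χ (Algebra.norm (ZMod p) (f.eval x)) = η).card : ℂ) * η) hinj]
    refine Finset.sum_congr rfl fun η hη => ?_
    rw [← hfilter η hη, ← nsmul_eq_mul, ← Finset.sum_const]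
    exact Finset.sum_congr rfl fun x hx => (Finset.mem_filter.1 hx).2
  have hcount : Z.card = ∑ i ∈ Finset.range d, (Finset.univ.filter
      fun x : GaloisField p (2 * k) => χ (Algebra.norm (ZMod p) (f.eval x)) = ζ ^ i).card := by
    rw [Finset.card_eq_sum_card_fiberwise hmaps, ← Finset.sum_image (g := (ζ ^ ·))
      (f := fun η => (Finset.univ.filter fun x : GaloisField p (2 * k) =>
        χ (Algebra.norm (ZMod p) (f.eval x)) = η).card) hinj]
    exact Finset.sum_congr rfl fun η hη => by rw [hfilter η hη]
  have hsum2 : ∑ x, χ (Algebra.norm (ZMod p) (f.eval x)) =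
      -∑ i ∈ Finset.range d, (a i : ℂ) * ζ ^ i := by
    rw [hsum, ha]
    push_cast
    simp only [sub_mul]
    rw [Finset.sum_sub_distrib, ← Finset.mul_sum, hζ.geom_sum_eq_zero hd2]
    ring
  have hzeros : ((p : ℝ) ^ k) ^ 2 ≤ Z.card + m := by
    have h1 : (Finset.univ.filter fun x : GaloisField p (2 * k) => ¬ f.eval x ≠ 0).card ≤ m := by
      have h2 : (Finset.univ.filter fun x : GaloisField p (2 * k) => ¬ f.eval x ≠ 0) ⊆
          f.roots.toFinset := by
        intro x hx
        simpa [hf0] using hx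
      refine (Finset.card_le_card h2).trans ((Multiset.toFinset_card_le _).trans ?_)
      rw [← hf]
      exact card_roots' f
    have h3 := Finset.card_filter_add_card_filter_not (s := (Finset.univ : Finset (GaloisField p (2 * k))))
      (fun x => f.eval x ≠ 0)
    rw [Finset.card_univ, hcard] at h3
    have : (p ^ k) ^ 2 ≤ Z.card + m := by rw [← h3, hZ]; gcongr
    exact_mod_cast this
  rw [hsum2, norm_neg]
  refine (norm_sum_le _ _).trans ?_
  have hterm : ∀ i ∈ Finset.range d, ‖(a i : ℂ) * ζ ^ i‖ = a i := by
    intro i _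
    rw [norm_mul, norm_pow, hζ.norm'_eq_one hdpos.ne', one_pow, mul_one, Complex.norm_real,
      Real.norm_of_nonneg (ha0 i)]
  rw [Finset.sum_congr rfl hterm, ha, Finset.sum_sub_distrib, ← Nat.cast_sum, ← hcount,
    Finset.sum_const, Finset.card_range, nsmul_eq_mul, mul_div_cancel₀ _ (by positivity)]
  have : (m : ℝ) ≤ m * (p : ℝ) ^ k :=
    le_mul_of_one_le_right (by positivity) (by exact_mod_cast hQpos)
  linarith

/-- The Weil bound for the triple character sum. -/
theorem norm_sum_triple_le {χ : MulChar (ZMod p) ℂ} (hχ : χ ≠ 1) (r₁ r₂ r₃ : ZMod p) :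
    ‖∑ t : ZMod p, χ (r₁ - t) * χ (r₂ - t) * χ⁻¹ (r₃ - t)‖ ≤ 2 * √p := by
  set w := tripleChar χ r₁ r₂ r₃ with hw
  set d := orderOf χ with hd
  have hdpos : 0 < d := χ.orderOf_pos
  have hd2 : 1 < d := by
    have : d ≠ 1 := fun h => hχ (orderOf_eq_one_iff.1 h)
    omega
  have hppos : 0 < p := (Fact.out : p.Prime).pos
  set S : ℕ → ℂ := fun n => ∑ x : GaloisField p n, w (galoisCharpoly x) with hS
  set c : ℕ → ℂ := fun n => ∑ g ∈ monicsOfDegree p n, w g with hc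
  have hnewton : ∀ n : ℕ, (n : ℂ) * c n = ∑ k ∈ Finset.Icc 1 n, S k * c (n - k) :=
    fun n => euler_product_log_deriv w n
  have hc0 : c 0 = 1 := sum_monicsOfDegree_zero w
  have hc3 : ∀ n, 3 ≤ n → c n = 0 := fun n hn => sum_tripleChar_eq_zero hχ r₁ r₂ r₃ hn
  have hc1 : c 1 = ∑ t : ZMod p, χ (r₁ - t) * χ (r₂ - t) * χ⁻¹ (r₃ - t) := by
    simp only [hc]
    rw [sum_monicsOfDegree_one]
    refine Finset.sum_congr rfl fun t _ => ?_
    rw [hw, tripleChar_apply]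
    simp
  rw [← hc1]
  have h1 : S 1 = c 1 := by
    have := hnewton 1
    simp [hc0] at this
    exact this.symm
  have h2 : 2 * c 2 = S 1 * c 1 + S 2 := by
    have := hnewton 2
    rw [show Finset.Icc 1 2 = {1, 2} by decide] at this
    simpa [hc0] using this
  have h3 : ∀ n ≥ 3, S n + S (n - 1) * c 1 + S (n - 2) * c 2 = 0 := by
    intro n hn
    have := hnewton n
    rw [hc3 n hn, mul_zero] at this
    rw [this, ← Finset.sum_subset (s₁ := {n, n - 1, n - 2})]
    · rw [Finset.sum_insert, Finset.sum_insert, Finset.sum_singleton, Nat.sub_self, hc0,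
        show n - (n - 1) = 1 by omega, show n - (n - 2) = 2 by omega]
      · ring
      · simp; omega
      · simp; omega
    · intro i hi
      simp only [Finset.mem_insert, Finset.mem_singleton] at hi
      rw [Finset.mem_Icc]
      omega
    · intro i hi hi'
      simp only [Finset.mem_insert, Finset.mem_singleton] at hi'
      rw [Finset.mem_Icc] at hi
      rw [hc3 (n - i) (by omega), mul_zero]
  have hS2 : ∀ k ≥ d * (d * (d + 1) * (d + 1 + 3) + (d + 1) + 4) + 1, ‖S (2 * k)‖ ≤
      ((d * (2 * (d + 1) + 3) + 1 : ℕ) + (d + 1 : ℕ) : ℝ) * (p : ℝ) ^ k := by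
    intro k hk
    set φ := algebraMap (ZMod p) (GaloisField p (2 * k)) with hφ
    have hlin : ∀ r : GaloisField p (2 * k), (C r - X).natDegree = 1 := fun r => by
      rw [← natDegree_neg, neg_sub, natDegree_X_sub_C]
    have hlin0 : ∀ r : GaloisField p (2 * k), (C r - X) ≠ 0 := fun r h => by
      have := hlin r
      rw [h] at this; simp at this
    set f : (GaloisField p (2 * k))[X] := (C (φ r₁) - X) * (C (φ r₂) - X) * (C (φ r₃) - X) ^ (d - 1)
      with hf
    have hf0 : f ≠ 0 := mul_ne_zero (mul_ne_zero (hlin0 _) (hlin0 _)) (pow_ne_zero _ (hlin0 _))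
    have hfd : f.natDegree = d + 1 := by
      rw [hf, natDegree_mul (mul_ne_zero (hlin0 _) (hlin0 _)) (pow_ne_zero _ (hlin0 _)),
        natDegree_mul (hlin0 _) (hlin0 _), natDegree_pow, hlin, hlin, hlin]
      omega
    have hSk : S (2 * k) = ∑ x, χ (Algebra.norm (ZMod p) (f.eval x)) := by
      refine Finset.sum_congr rfl fun x _ => ?_
      have hinv : χ⁻¹ = χ ^ (d - 1) := by
        rw [inv_eq_iff_mul_eq_one, ← pow_succ', Nat.sub_add_cancel hdpos, hd, pow_orderOf_eq_one]
      rw [hw, tripleChar_apply, eval_galoisCharpoly (by omega), eval_galoisCharpoly (by omega),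
        eval_galoisCharpoly (by omega), hinv, MulChar.pow_apply' _ (by omega), hf]
      simp only [eval_mul, eval_pow, eval_sub, eval_C, eval_X, map_mul, map_pow, hφ]
    rw [hSk]
    refine norm_sum_mulChar_norm_le hχ (by omega) hfd hf0 ?_ ?_
    · rw [← hd]
      simp
    · rw [← hd]
      exact lt_of_lt_of_le (by omega) (Nat.lt_pow_self (Fact.out : p.Prime).one_lt).le
  exact norm_le_two_sqrt_of_newton h1 h2 h3 (by exact_mod_cast hppos) hS2

end Weil

section FourthMoment

lemma norm_mulChar_le_one {p : ℕ} (χ : MulChar (ZMod p) ℂ) (a : ZMod p) : ‖χ a‖ ≤ 1 :=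
  DirichletCharacter.norm_le_one χ a

variable {p : ℕ} [Fact p.Prime]

/-- The correlation sum of four shifts of a character. -/
noncomputable def correlation (χ : MulChar (ZMod p) ℂ) (b₁ b₂ b₃ b₄ : ZMod p) : ℂ :=
  ∑ x : ZMod p, χ (x + b₁) * χ (x + b₂) * (χ⁻¹ (x + b₃) * χ⁻¹ (x + b₄))

lemma norm_correlation_le_card (χ : MulChar (ZMod p) ℂ) (b₁ b₂ b₃ b₄ : ZMod p) :
    ‖correlation χ b₁ b₂ b₃ b₄‖ ≤ p := by
  refine (norm_sum_le_of_le (f := fun _ : ZMod p => _) Finset.univ (n := fun _ => 1) fun x _ => ?_).trans ?_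
  · rw [norm_mul, norm_mul, norm_mul]
    exact mul_le_one₀ (mul_le_one₀ (norm_mulChar_le_one _ _) (norm_nonneg _)
      (norm_mulChar_le_one _ _)) (by positivity) (mul_le_one₀ (norm_mulChar_le_one _ _)
      (norm_nonneg _) (norm_mulChar_le_one _ _))
  · simp [ZMod.card]

lemma norm_correlation_le_of_ne {χ : MulChar (ZMod p) ℂ} (hχ : χ ≠ 1) {b₁ b₂ b₃ b₄ : ZMod p}
    (h1 : b₁ ≠ b₄) (h2 : b₂ ≠ b₄) (h3 : b₃ ≠ b₄) :
    ‖correlation χ b₁ b₂ b₃ b₄‖ ≤ 2 * √p + 1 := by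
  have hinv : ∀ a : ZMod p, a ≠ 0 → χ a * χ⁻¹ a = 1 := fun a ha => by
    rw [← MulChar.mul_apply, mul_inv_cancel, MulChar.one_apply ha.isUnit]
  have hshift : correlation χ b₁ b₂ b₃ b₄ = ∑ t : ZMod p,
      χ (t⁻¹ + (b₁ - b₄)) * χ (t⁻¹ + (b₂ - b₄)) * (χ⁻¹ (t⁻¹ + (b₃ - b₄)) * χ⁻¹ t⁻¹) := by
    rw [correlation, ← Equiv.sum_comp (Equiv.subRight b₄), ← Equiv.sum_comp (Equiv.inv (ZMod p))]
    refine Finset.sum_congr rfl fun t _ => ?_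
    have h : ∀ b, t⁻¹ - b₄ + b = t⁻¹ + (b - b₄) := fun b => by ring
    simp only [Equiv.subRight_apply, Equiv.inv_apply, h, sub_self, add_zero]
  have hlin : ∀ (ψ : MulChar (ZMod p) ℂ) (c t : ZMod p), c ≠ 0 →
      ψ (1 + c * t) = ψ (-c) * ψ (-c⁻¹ - t) := by
    intro ψ c t hc
    rw [← map_mul]
    congr 1
    field_simp
    ring
  have hterm : ∀ t : ZMod p, χ (t⁻¹ + (b₁ - b₄)) * χ (t⁻¹ + (b₂ - b₄)) *
      (χ⁻¹ (t⁻¹ + (b₃ - b₄)) * χ⁻¹ t⁻¹) =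
      χ (1 + (b₁ - b₄) * t) * χ (1 + (b₂ - b₄) * t) * χ⁻¹ (1 + (b₃ - b₄) * t) -
        if t = 0 then 1 else 0 := by
    intro t
    by_cases ht : t = 0
    · subst ht
      simp [MulChar.map_zero]
    · have h : ∀ (ψ : MulChar (ZMod p) ℂ) (c : ZMod p), ψ (t⁻¹ + c) = ψ t⁻¹ * ψ (1 + c * t) := by
        intro ψ c
        rw [← map_mul]
        congr 1
        field_simp
      rw [h, h, h, if_neg ht, sub_zero]
      have h4 := hinv t⁻¹ (inv_ne_zero ht)
      linear_combination (χ (1 + (b₁ - b₄) * t) * χ (1 + (b₂ - b₄) * t) *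
        χ⁻¹ (1 + (b₃ - b₄) * t)) * (χ t⁻¹ * χ⁻¹ t⁻¹ + 1) * h4
  rw [hshift, Finset.sum_congr rfl fun t _ => hterm t, Finset.sum_sub_distrib]
  refine (norm_sub_le _ _).trans (add_le_add ?_ ?_)
  · have : ∀ t : ZMod p, χ (1 + (b₁ - b₄) * t) * χ (1 + (b₂ - b₄) * t) *
        χ⁻¹ (1 + (b₃ - b₄) * t) = (χ (-(b₁ - b₄)) * χ (-(b₂ - b₄)) * χ⁻¹ (-(b₃ - b₄))) *
        (χ (-(b₁ - b₄)⁻¹ - t) * χ (-(b₂ - b₄)⁻¹ - t) * χ⁻¹ (-(b₃ - b₄)⁻¹ - t)) := by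
      intro t
      rw [hlin χ _ t (sub_ne_zero.2 h1), hlin χ _ t (sub_ne_zero.2 h2),
        hlin χ⁻¹ _ t (sub_ne_zero.2 h3)]
      ring
    rw [Finset.sum_congr rfl fun t _ => this t, ← Finset.mul_sum, norm_mul, norm_mul, norm_mul]
    have h5 : ‖χ (-(b₁ - b₄))‖ * ‖χ (-(b₂ - b₄))‖ * ‖χ⁻¹ (-(b₃ - b₄))‖ ≤ 1 :=
      mul_le_one₀ (mul_le_one₀ (norm_mulChar_le_one _ _) (norm_nonneg _)
        (norm_mulChar_le_one _ _)) (norm_nonneg _) (norm_mulChar_le_one _ _)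
    exact (mul_le_of_le_one_left (norm_nonneg _) h5).trans (norm_sum_triple_le hχ _ _ _)
  · simp

lemma correlation_swap_right (χ : MulChar (ZMod p) ℂ) (b₁ b₂ b₃ b₄ : ZMod p) :
    correlation χ b₁ b₂ b₃ b₄ = correlation χ b₁ b₂ b₄ b₃ :=
  Finset.sum_congr rfl fun x _ => by ring

lemma correlation_inv (χ : MulChar (ZMod p) ℂ) (b₁ b₂ b₃ b₄ : ZMod p) :
    correlation χ b₁ b₂ b₃ b₄ = correlation χ⁻¹ b₃ b₄ b₁ b₂ :=
  Finset.sum_congr rfl fun x _ => by rw [inv_inv]; ring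

lemma norm_correlation_le {χ : MulChar (ZMod p) ℂ} (hχ : χ ≠ 1) (b₁ b₂ b₃ b₄ : ZMod p) :
    ‖correlation χ b₁ b₂ b₃ b₄‖ ≤ (2 * √p + 1) +
      ((if b₁ = b₂ then (if b₃ = b₄ then (p : ℝ) else 0) else 0) +
      (if b₁ = b₃ then (if b₂ = b₄ then (p : ℝ) else 0) else 0) +
      (if b₂ = b₃ then (if b₁ = b₄ then (p : ℝ) else 0) else 0)) := by
  have hp : (0 : ℝ) ≤ p := p.cast_nonneg
  have hs : 0 ≤ √(p : ℝ) := Real.sqrt_nonneg _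
  have hχ' : χ⁻¹ ≠ 1 := inv_ne_one.2 hχ
  by_cases hpair : (b₁ = b₂ ∧ b₃ = b₄) ∨ (b₁ = b₃ ∧ b₂ = b₄) ∨ (b₂ = b₃ ∧ b₁ = b₄)
  · have := norm_correlation_le_card χ b₁ b₂ b₃ b₄
    split_ifs <;> first | linarith | (exfalso; tauto)
  · have key : ‖correlation χ b₁ b₂ b₃ b₄‖ ≤ 2 * √p + 1 := by
      have hiso : (b₁ ≠ b₄ ∧ b₂ ≠ b₄ ∧ b₃ ≠ b₄) ∨ (b₁ ≠ b₃ ∧ b₂ ≠ b₃ ∧ b₄ ≠ b₃) ∨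
          (b₃ ≠ b₂ ∧ b₄ ≠ b₂ ∧ b₁ ≠ b₂) ∨ (b₃ ≠ b₁ ∧ b₄ ≠ b₁ ∧ b₂ ≠ b₁) := by
        grind
      rcases hiso with ⟨h1, h2, h3⟩ | ⟨h1, h2, h3⟩ | ⟨h1, h2, h3⟩ | ⟨h1, h2, h3⟩
      · exact norm_correlation_le_of_ne hχ h1 h2 h3
      · rw [correlation_swap_right]
        exact norm_correlation_le_of_ne hχ h1 h2 h3
      · rw [correlation_inv]
        exact norm_correlation_le_of_ne hχ' h1 h2 h3
      · rw [correlation_inv, correlation_swap_right]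
        exact norm_correlation_le_of_ne hχ' h1 h2 h3
    refine key.trans (le_add_of_nonneg_right ?_)
    positivity

/-- The fourth moment of short character sums. -/
theorem sum_norm_pow_four_le {χ : MulChar (ZMod p) ℂ} (hχ : χ ≠ 1) (s : Finset (ZMod p)) :
    ∑ x : ZMod p, ‖∑ b ∈ s, χ (x + b)‖ ^ 4 ≤
      3 * (s.card : ℝ) ^ 2 * p + (s.card : ℝ) ^ 4 * (2 * √p + 1) := by
  have hexp : ((∑ x : ZMod p, ‖∑ b ∈ s, χ (x + b)‖ ^ 4 : ℝ) : ℂ) =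
      ∑ b₁ ∈ s, ∑ b₂ ∈ s, ∑ b₃ ∈ s, ∑ b₄ ∈ s, correlation χ b₁ b₂ b₃ b₄ := by
    have hstar : ∀ x : ZMod p, (starRingEnd ℂ) (∑ b ∈ s, χ (x + b)) = ∑ b ∈ s, χ⁻¹ (x + b) := by
      intro x
      rw [map_sum]
      refine Finset.sum_congr rfl fun b _ => ?_
      exact MulChar.star_apply' χ _
    have hx : ∀ x : ZMod p, ((‖∑ b ∈ s, χ (x + b)‖ ^ 4 : ℝ) : ℂ) =
        ∑ b₁ ∈ s, ∑ b₂ ∈ s, ∑ b₃ ∈ s, ∑ b₄ ∈ s,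
          χ (x + b₁) * χ (x + b₂) * (χ⁻¹ (x + b₃) * χ⁻¹ (x + b₄)) := by
      intro x
      have h1 : ((‖∑ b ∈ s, χ (x + b)‖ ^ 4 : ℝ) : ℂ) =
          ((∑ b ∈ s, χ (x + b)) * (∑ b ∈ s, χ (x + b))) *
          ((∑ b ∈ s, χ⁻¹ (x + b)) * (∑ b ∈ s, χ⁻¹ (x + b))) := by
        rw [← hstar]
        have := Complex.mul_conj' (∑ b ∈ s, χ (x + b))
        push_cast
        linear_combination (-(‖∑ b ∈ s, χ (x + b)‖ : ℂ) ^ 2 -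
          (∑ b ∈ s, χ (x + b)) * (starRingEnd ℂ) (∑ b ∈ s, χ (x + b))) * this
      rw [h1]
      rw [Finset.sum_mul_sum, Finset.sum_mul_sum, Finset.sum_mul]
      refine Finset.sum_congr rfl fun b₁ _ => ?_
      rw [Finset.sum_mul]
      refine Finset.sum_congr rfl fun b₂ _ => ?_
      rw [Finset.mul_sum]
      refine Finset.sum_congr rfl fun b₃ _ => ?_
      rw [Finset.mul_sum]
    rw [Complex.ofReal_sum, Finset.sum_congr rfl fun x _ => hx x, Finset.sum_comm]
    refine Finset.sum_congr rfl fun b₁ _ => ?_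
    rw [Finset.sum_comm]
    refine Finset.sum_congr rfl fun b₂ _ => ?_
    rw [Finset.sum_comm]
    refine Finset.sum_congr rfl fun b₃ _ => ?_
    rw [Finset.sum_comm]
    rfl
  have h0 : 0 ≤ ∑ x : ZMod p, ‖∑ b ∈ s, χ (x + b)‖ ^ 4 := by positivity
  rw [← Real.norm_of_nonneg h0, ← Complex.norm_real, hexp]
  refine (norm_sum_le_of_le _ fun b₁ _ => norm_sum_le_of_le _ fun b₂ _ =>
    norm_sum_le_of_le _ fun b₃ _ => norm_sum_le_of_le _ fun b₄ _ =>
      norm_correlation_le hχ b₁ b₂ b₃ b₄).trans (le_of_eq ?_)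
  simp only [Finset.sum_add_distrib, Finset.sum_const, nsmul_eq_mul]
  have hA : ∑ b₁ ∈ s, ∑ b₂ ∈ s, ∑ b₃ ∈ s, ∑ b₄ ∈ s,
      (if b₁ = b₂ then (if b₃ = b₄ then (p : ℝ) else 0) else 0) = (s.card : ℝ) ^ 2 * p := by
    have : ∀ b₁ ∈ s, ∑ b₂ ∈ s, ∑ b₃ ∈ s, ∑ b₄ ∈ s,
      (if b₁ = b₂ then (if b₃ = b₄ then (p : ℝ) else 0) else 0) = s.card * p := by
      intro b₁ h₁
      rw [Finset.sum_eq_single_of_mem b₁ h₁ (fun b _ hb => by simp [hb.symm])]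
      rw [Finset.sum_congr rfl fun b₃ h₃ => by
        rw [Finset.sum_congr rfl fun b₄ _ => if_pos rfl, Finset.sum_ite_eq, if_pos h₃]]
      simp
    rw [Finset.sum_congr rfl this]
    simp; ring
  have hB : ∑ b₁ ∈ s, ∑ b₂ ∈ s, ∑ b₃ ∈ s, ∑ b₄ ∈ s,
      (if b₁ = b₃ then (if b₂ = b₄ then (p : ℝ) else 0) else 0) = (s.card : ℝ) ^ 2 * p := by
    rw [← hA]
    exact Finset.sum_congr rfl fun b₁ _ => Finset.sum_comm
  have hC : ∑ b₁ ∈ s, ∑ b₂ ∈ s, ∑ b₃ ∈ s, ∑ b₄ ∈ s,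
      (if b₂ = b₃ then (if b₁ = b₄ then (p : ℝ) else 0) else 0) = (s.card : ℝ) ^ 2 * p := by
    rw [← hB, Finset.sum_comm]
  rw [hA, hB, hC]
  ring

end FourthMoment

section ProportionalPairs

open Finset

lemma sum_card_divisors_le (A : ℕ) :
    ∑ a ∈ Icc 1 A, (a.divisors.card : ℝ) ≤ A * (1 + Real.log A) := by
  have h1 : ∀ a ∈ Icc 1 A, (a.divisors.card : ℝ) = ∑ d ∈ Icc 1 A, if d ∣ a then 1 else 0 := by
    intro a ha
    rw [mem_Icc] at ha
    rw [Finset.sum_boole]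
    congr 2
    ext d
    rw [Nat.mem_divisors, mem_filter, mem_Icc]
    constructor
    · rintro ⟨h, h0⟩
      exact ⟨⟨Nat.pos_of_dvd_of_pos h ha.1, (Nat.le_of_dvd ha.1 h).trans ha.2⟩, h⟩
    · rintro ⟨-, h⟩
      exact ⟨h, by omega⟩
  rw [sum_congr rfl h1, sum_comm]
  have h2 : ∀ d ∈ Icc 1 A, ∑ a ∈ Icc 1 A, (if d ∣ a then (1 : ℝ) else 0) ≤ A * (d : ℝ)⁻¹ := by
    intro d _
    rw [Finset.sum_boole]
    have := Nat.Ioc_filter_dvd_card_eq_div A d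
    rw [show Icc 1 A = Ioc 0 A from rfl, this, ← div_eq_mul_inv]
    exact Nat.cast_div_le
  refine (sum_le_sum h2).trans ?_
  rw [← mul_sum]
  gcongr
  have := harmonic_le_one_add_log A
  rw [harmonic_eq_sum_Icc] at this
  push_cast at this
  exact this

lemma sum_gcd_le (a : ℕ) : ∑ b ∈ Icc 1 a, b.gcd a ≤ a * a.divisors.card := by
  rcases Nat.eq_zero_or_pos a with rfl | ha
  · simp
  have hmaps : ∀ b ∈ Icc 1 a, b.gcd a ∈ a.divisors := fun b _ =>
    Nat.mem_divisors.2 ⟨Nat.gcd_dvd_right b a, ha.ne'⟩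
  rw [← sum_fiberwise_of_maps_to hmaps]
  have h : ∀ g ∈ a.divisors, ∑ b ∈ Icc 1 a with b.gcd a = g, b.gcd a ≤ a := by
    intro g hg
    have hga := (Nat.mem_divisors.1 hg).1
    rw [sum_congr rfl (g := fun _ => g) fun b hb => (mem_filter.1 hb).2, sum_const, smul_eq_mul]
    have hsub : (Icc 1 a).filter (fun b => b.gcd a = g) ⊆ (Ioc 0 a).filter (fun b => g ∣ b) := by
      intro b hb
      rw [mem_filter] at hb ⊢
      exact ⟨hb.1, hb.2 ▸ Nat.gcd_dvd_left b a⟩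
    have h1 := card_le_card hsub
    rw [Nat.Ioc_filter_dvd_card_eq_div] at h1
    exact (Nat.mul_le_mul_right _ h1).trans (Nat.div_mul_le_self a g)
  refine (sum_le_sum h).trans ?_
  rw [sum_const, smul_eq_mul, mul_comm]

lemma sum_gcd_div_max_le (A : ℕ) :
    ∑ a ∈ Icc 1 A, ∑ b ∈ Icc 1 A, (a.gcd b : ℝ) / max a b ≤ 2 * (A * (1 + Real.log A)) := by
  have h1 : ∀ a ∈ Icc 1 A, ∑ b ∈ Icc 1 A, (if b ≤ a then (b.gcd a : ℝ) / a else 0) ≤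
      a.divisors.card := by
    intro a ha
    rw [mem_Icc] at ha
    rw [← sum_filter]
    have : (Icc 1 A).filter (· ≤ a) = Icc 1 a := by
      ext b
      rw [mem_filter, mem_Icc, mem_Icc]
      omega
    rw [this, ← sum_div, div_le_iff₀ (by exact_mod_cast ha.1), mul_comm]
    exact_mod_cast sum_gcd_le a
  have h2 : ∀ a ∈ Icc 1 A, ∀ b ∈ Icc 1 A, (a.gcd b : ℝ) / max a b ≤
      (if b ≤ a then (b.gcd a : ℝ) / a else 0) + (if a ≤ b then (a.gcd b : ℝ) / b else 0) := by
    intro a _ b _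
    rcases le_total b a with h | h
    · rw [if_pos h, max_eq_left (by exact_mod_cast h), Nat.gcd_comm]
      refine le_add_of_nonneg_right ?_
      positivity
    · rw [if_pos h, max_eq_right (by exact_mod_cast h)]
      refine le_add_of_nonneg_left ?_
      positivity
  refine (sum_le_sum fun a ha => sum_le_sum (h2 a ha)).trans ?_
  simp only [sum_add_distrib]
  rw [add_comm, sum_comm, ← two_mul]
  gcongr
  exact (sum_le_sum h1).trans (sum_card_divisors_le A)

/-- The pairs in a short interval lying on a line of slope `b / a` modulo `p`. -/
noncomputable def proportionalPairs (p : ℕ) (N : ℤ) (H a b : ℕ) : Finset (ℤ × ℤ) :=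
  ((Ioc N (N + H)) ×ˢ (Ioc N (N + H))).filter fun n => (p : ℤ) ∣ a * n.2 - b * n.1

lemma card_proportionalPairs_comm (p : ℕ) (N : ℤ) (H a b : ℕ) :
    (proportionalPairs p N H a b).card = (proportionalPairs p N H b a).card := by
  refine card_nbij' Prod.swap Prod.swap ?_ ?_ (fun _ _ => rfl) (fun _ _ => rfl)
  all_goals
    rintro ⟨m, n⟩ h
    simp only [proportionalPairs, mem_coe, mem_filter, mem_product, Prod.swap_prod_mk] at h ⊢
    exact ⟨⟨h.1.2, h.1.1⟩, by rw [← dvd_neg, neg_sub]; exact h.2⟩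

lemma card_proportionalPairs_coprime {p : ℕ} (hp : 0 < p) (N : ℤ) {H a b : ℕ} (hH : 0 < H)
    (hab : a ≤ b) (hb : 0 < b) (hcop : a.Coprime b) :
    ((proportionalPairs p N H a b).card : ℝ) ≤ (2 * b * H / p + 1) * (H / b + 1) := by
  set m : ℤ := N * (a - b) + a - b * H with hm
  have hpz : (0 : ℤ) < p := by exact_mod_cast hp
  have hbz : (0 : ℤ) < b := by exact_mod_cast hb
  have hinj : (proportionalPairs p N H a b).card ≤
      ((Icc (0 : ℤ) (2 * b * H / p)) ×ˢ (Icc (0 : ℤ) (H / b))).card := by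
    refine card_le_card_of_injOn (fun n => ((a * n.2 - b * n.1 - m) / p, (n.2 - N - 1) / b)) ?_ ?_
    · rintro ⟨x, y⟩ h
      simp only [proportionalPairs, mem_coe, mem_filter, mem_product, mem_Ioc] at h
      obtain ⟨⟨⟨hx1, hx2⟩, hy1, hy2⟩, -⟩ := h
      simp only [mem_coe, mem_product, mem_Icc]
      have haz : (0 : ℤ) ≤ a := by positivity
      have habz : (a : ℤ) ≤ b := by exact_mod_cast hab
      have e1 : (a : ℤ) * y - b * x - m = a * (y - N - 1) + b * (N + H - x) := by rw [hm]; ring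
      have e2 : (0 : ℤ) ≤ a * (y - N - 1) := mul_nonneg haz (by omega)
      have e3 : (0 : ℤ) ≤ b * (N + H - x) := mul_nonneg hbz.le (by omega)
      have e4 : (a : ℤ) * (y - N - 1) ≤ b * H := mul_le_mul habz (by omega) (by omega) (by omega)
      have e5 : (b : ℤ) * (N + H - x) ≤ b * H := mul_le_mul_of_nonneg_left (by omega) hbz.le
      refine ⟨⟨Int.ediv_nonneg (by omega) hpz.le, Int.ediv_le_ediv hpz ?_⟩,
        Int.ediv_nonneg (by omega) hbz.le, Int.ediv_le_ediv hbz (by omega)⟩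
      rw [e1]; linarith
    · rintro ⟨x, y⟩ h ⟨x', y'⟩ h' heq
      simp only [proportionalPairs, mem_coe, mem_filter, mem_product, mem_Ioc] at h h'
      obtain ⟨-, k, hk⟩ := h
      obtain ⟨-, k', hk'⟩ := h'
      simp only [Prod.mk.injEq, hk, hk'] at heq
      obtain ⟨heq1, heq2⟩ := heq
      rw [sub_eq_add_neg, sub_eq_add_neg, Int.add_comm, Int.add_comm (p * k'),
        Int.add_mul_ediv_left _ _ hpz.ne', Int.add_mul_ediv_left _ _ hpz.ne'] at heq1
      have hkk : k = k' := by omega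
      rw [← hkk] at hk'
      have hdvd : (b : ℤ) ∣ y - y' := by
        have h1 : (b : ℤ) ∣ a * (y - y') := ⟨x - x', by linear_combination hk - hk'⟩
        exact IsCoprime.dvd_of_dvd_mul_left (Nat.isCoprime_iff_coprime.2 hcop.symm) h1
      have hyy : y = y' := by
        have h1 := Int.emod_add_mul_ediv (y - N - 1) b
        have h2 := Int.emod_add_mul_ediv (y' - N - 1) b
        have h3 : (y - N - 1) % b = (y' - N - 1) % b := by
          refine (Int.ModEq.symm ((Int.modEq_iff_dvd).2 ?_))
          convert hdvd using 1; ring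
          
        rw [heq2, h3] at h1
        omega
      subst hyy
      have : (b : ℤ) * x = b * x' := by linarith
      rw [mul_left_cancel₀ hbz.ne' this]
  have hcard : ∀ (u v : ℕ), ((Icc (0 : ℤ) ((u : ℤ) / v)).card : ℝ) ≤ u / v + 1 := by
    intro u v
    rw [Int.card_Icc, sub_zero, ← Int.natCast_ediv, ← Nat.cast_succ, Int.toNat_natCast]
    push_cast
    gcongr
    exact Nat.cast_div_le
  refine (Nat.cast_le.2 hinj).trans ?_
  rw [card_product, Nat.cast_mul]
  have h1 := hcard (2 * b * H) p
  have h2 := hcard H b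
  push_cast at h1 h2
  exact mul_le_mul h1 h2 (by positivity) (by positivity)

lemma card_proportionalPairs_of_le {p : ℕ} (hp : p.Prime) (N : ℤ) {H a b A : ℕ} (hH : 0 < H)
    (ha : 0 < a) (hab : a ≤ b) (hbA : b ≤ A) (hA : A < p) :
    ((proportionalPairs p N H a b).card : ℝ) ≤
      2 * H ^ 2 / p + 2 * A * H / p + 1 + H * (a.gcd b / max a b) := by
  have hg : 0 < a.gcd b := Nat.gcd_pos_of_pos_left b ha
  obtain ⟨α, hα⟩ := Nat.gcd_dvd_left a b
  obtain ⟨β, hβ⟩ := Nat.gcd_dvd_right a b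
  have hcop : α.Coprime β := by
    have h1 := Nat.coprime_div_gcd_div_gcd hg
    rwa [Nat.div_eq_of_eq_mul_right hg hα, Nat.div_eq_of_eq_mul_right hg hβ] at h1
  have hαβ : α ≤ β := by
    refine Nat.le_of_mul_le_mul_left ?_ hg
    rwa [← hα, ← hβ]
  have hβ0 : 0 < β := by
    rcases Nat.eq_zero_or_pos β with h | h
    · rw [h] at hβ; omega
    · exact h
  have hset : proportionalPairs p N H a b ⊆ proportionalPairs p N H α β := by
    intro n hn
    simp only [proportionalPairs, mem_filter] at hn ⊢
    refine ⟨hn.1, ?_⟩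
    have h1 : (p : ℤ) ∣ (a.gcd b : ℤ) * (α * n.2 - β * n.1) := by
      have : (a.gcd b : ℤ) * (α * n.2 - β * n.1) = a * n.2 - b * n.1 := by
        have h2 : (a : ℤ) = a.gcd b * α := by exact_mod_cast hα
        have h3 : (b : ℤ) = a.gcd b * β := by exact_mod_cast hβ
        linear_combination (-n.2) * h2 + n.1 * h3
      rw [this]; exact hn.2
    refine (Int.Prime.dvd_mul' hp h1).resolve_left fun h => ?_
    have h2 := Nat.le_of_dvd hg (Int.natCast_dvd_natCast.1 h)
    have h3 := Nat.gcd_le_right a (ha.trans_le hab)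
    omega
  have h1 := (Nat.cast_le (α := ℝ).2 (card_le_card hset)).trans
    (card_proportionalPairs_coprime hp.pos N hH hαβ hβ0 hcop)
  refine h1.trans ?_
  have hp0 : (0 : ℝ) < p := by exact_mod_cast hp.pos
  have hβr : (0 : ℝ) < β := by exact_mod_cast hβ0
  have hgr : (0 : ℝ) < a.gcd b := by exact_mod_cast hg
  have h2 : (a.gcd b / max a b : ℝ) = 1 / β := by
    rw [max_eq_right (by exact_mod_cast hab)]
    have : (b : ℝ) = a.gcd b * β := by exact_mod_cast hβ
    conv_lhs => rw [this]
    field_simp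
  rw [h2]
  have h3 : (β : ℝ) ≤ A := by
    have : β ≤ b := Nat.le_of_dvd (ha.trans_le hab) ⟨a.gcd b, by rw [mul_comm]; exact hβ⟩
    exact_mod_cast this.trans hbA
  have h4 : (2 * β * H / p + 1 : ℝ) * (H / β + 1) =
      2 * H ^ 2 / p + 2 * β * H / p + 1 + H * (1 / β) := by
    field_simp
    ring
  rw [h4]
  gcongr

theorem sum_card_proportionalPairs_le {p : ℕ} (hp : p.Prime) (N : ℤ) {H A : ℕ} (hH : 0 < H)
    (hA : A < p) :
    ∑ a ∈ Icc 1 A, ∑ b ∈ Icc 1 A, ((proportionalPairs p N H a b).card : ℝ) ≤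
      A ^ 2 * (2 * H ^ 2 / p + 2 * A * H / p + 1) + 2 * H * A * (1 + Real.log A) := by
  have h : ∀ a ∈ Icc 1 A, ∀ b ∈ Icc 1 A, ((proportionalPairs p N H a b).card : ℝ) ≤
      (2 * H ^ 2 / p + 2 * A * H / p + 1) + H * (a.gcd b / max a b) := by
    intro a ha b hb
    rw [mem_Icc] at ha hb
    rcases le_total a b with hab | hab
    · exact card_proportionalPairs_of_le hp N hH ha.1 hab hb.2 hA
    · rw [card_proportionalPairs_comm, Nat.gcd_comm, max_comm]
      exact card_proportionalPairs_of_le hp N hH hb.1 hab ha.2 hA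
  refine (sum_le_sum fun a ha => sum_le_sum (h a ha)).trans ?_
  simp only [sum_add_distrib, ← mul_sum]
  have h2 := sum_gcd_div_max_le A
  have h3 : (H : ℝ) * ∑ a ∈ Icc 1 A, ∑ b ∈ Icc 1 A, (a.gcd b : ℝ) / max a b ≤
      H * (2 * (A * (1 + Real.log A))) := by gcongr
  simp only [sum_const, Nat.card_Icc, nsmul_eq_mul, Nat.add_sub_cancel]
  linarith

end ProportionalPairs

section Amplification

open Finset

/-- Hölder's inequality for a sum over the fibres of a map. -/
lemma sum_comp_pow_four_le {ι X : Type*} [Fintype X] [DecidableEq X] (I : Finset ι) (f : ι → X)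
    (w : X → ℝ) :
    (∑ i ∈ I, w (f i)) ^ 4 ≤ (I.card : ℝ) ^ 2 *
      (∑ i ∈ I, ∑ j ∈ I, if f i = f j then (1 : ℝ) else 0) * ∑ x, w x ^ 4 := by
  set v : X → ℝ := fun x => ∑ i ∈ I, if f i = x then (1 : ℝ) else 0 with hv
  have hv0 : ∀ x, 0 ≤ v x := fun x => by positivity
  have hw : ∀ g : X → ℝ, ∑ i ∈ I, g (f i) = ∑ x, v x * g x := by
    intro g
    simp only [hv, sum_mul, ite_mul, one_mul, zero_mul]
    rw [sum_comm]
    simp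
  have hv1 : ∑ x, v x = I.card := by
    have := hw fun _ => 1
    simpa using this.symm
  have hv2 : ∑ i ∈ I, ∑ j ∈ I, (if f i = f j then (1 : ℝ) else 0) = ∑ x, v x ^ 2 := by
    have := hw v
    simp only [← sq] at this
    rw [← this]
    refine sum_congr rfl fun i _ => sum_congr rfl fun j _ => ?_
    simp only [eq_comm]
  rw [hw w, hv2]
  have hcs1 : (∑ x, v x * w x) ^ 2 ≤ (∑ x, v x) * ∑ x, v x * w x ^ 2 :=
    sum_sq_le_sum_mul_sum_of_sq_le_mul _ (fun x _ => hv0 x)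
      (fun x _ => mul_nonneg (hv0 x) (sq_nonneg _)) fun x _ => le_of_eq (by ring)
  have hcs2 : (∑ x, v x * w x ^ 2) ^ 2 ≤ (∑ x, v x ^ 2) * ∑ x, w x ^ 4 :=
    sum_sq_le_sum_mul_sum_of_sq_le_mul _ (fun x _ => sq_nonneg _)
      (fun x _ => by positivity) fun x _ => le_of_eq (by ring)
  rw [hv1] at hcs1
  calc (∑ x, v x * w x) ^ 4 = ((∑ x, v x * w x) ^ 2) ^ 2 := by ring
    _ ≤ (I.card * ∑ x, v x * w x ^ 2) ^ 2 := by gcongr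
    _ = (I.card : ℝ) ^ 2 * (∑ x, v x * w x ^ 2) ^ 2 := by ring
    _ ≤ (I.card : ℝ) ^ 2 * ((∑ x, v x ^ 2) * ∑ x, w x ^ 4) := by gcongr
    _ = _ := by ring

variable {p : ℕ} [Fact p.Prime]

/-- The average over shifts `n ↦ n + a b`, bounded through the fourth moment. -/
lemma sum_norm_shifted_pow_four_le {χ : MulChar (ZMod p) ℂ} (hχ : χ ≠ 1) (N : ℤ) {H A B : ℕ}
    (hH : 0 < H) (hA : A < p) (hB : B < p) :
    (∑ a ∈ Icc 1 A, ∑ n ∈ Ioc N (N + H), ‖∑ b ∈ Icc 1 B, χ ((n : ZMod p) + a * b)‖) ^ 4 ≤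
      (A * H : ℝ) ^ 2 *
      (A ^ 2 * (2 * H ^ 2 / p + 2 * A * H / p + 1) + 2 * H * A * (1 + Real.log A)) *
      (3 * (B : ℝ) ^ 2 * p + (B : ℝ) ^ 4 * (2 * √p + 1)) := by
  have hp : p.Prime := Fact.out
  set s : Finset (ZMod p) := (Icc 1 B).image (fun b : ℕ => (b : ZMod p)) with hs
  have hinj : Set.InjOn (fun b : ℕ => (b : ZMod p)) (Icc 1 B : Set ℕ) := by
    intro b hb b' hb' h
    simp only [coe_Icc, Set.mem_Icc] at hb hb'
    have := (ZMod.natCast_eq_natCast_iff' b b' p).1 h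
    rwa [Nat.mod_eq_of_lt (by omega), Nat.mod_eq_of_lt (by omega)] at this
  have hscard : s.card = B := by rw [hs, card_image_of_injOn hinj]; simp
  have hane : ∀ a ∈ Icc 1 A, (a : ZMod p) ≠ 0 := by
    intro a ha h
    rw [mem_Icc] at ha
    rw [ZMod.natCast_eq_zero_iff] at h
    have := Nat.le_of_dvd ha.1 h
    omega
  set w : ZMod p → ℝ := fun x => ‖∑ b ∈ s, χ (x + b)‖ with hw
  set I : Finset (ℕ × ℤ) := Icc 1 A ×ˢ Ioc N (N + H) with hI
  set f : ℕ × ℤ → ZMod p := fun i => (i.2 : ZMod p) * (i.1 : ZMod p)⁻¹ with hf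
  have hsum : ∑ a ∈ Icc 1 A, ∑ n ∈ Ioc N (N + H), ‖∑ b ∈ Icc 1 B, χ ((n : ZMod p) + a * b)‖ =
      ∑ i ∈ I, w (f i) := by
    rw [hI, sum_product]
    refine sum_congr rfl fun a ha => sum_congr rfl fun n _ => ?_
    have ha0 := hane a ha
    have h1 : ∀ b ∈ Icc 1 B, χ ((n : ZMod p) + a * b) = χ a * χ (n * (a : ZMod p)⁻¹ + b) := by
      intro b _
      rw [← map_mul]
      congr 1
      field_simp
    have h2 : ‖χ (a : ZMod p)‖ = 1 := by
      have := DirichletCharacter.unit_norm_eq_one χ (Units.mk0 _ ha0)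
      simpa using this
    rw [sum_congr rfl h1, ← mul_sum, norm_mul, h2, one_mul]
    simp only [hw, hf, hs]
    rw [sum_image hinj]
  have hcoll : ∑ i ∈ I, ∑ j ∈ I, (if f i = f j then (1 : ℝ) else 0) =
      ∑ a ∈ Icc 1 A, ∑ b ∈ Icc 1 A, ((proportionalPairs p N H a b).card : ℝ) := by
    rw [hI, sum_product]
    simp only [sum_product]
    refine sum_congr rfl fun a ha => ?_
    rw [sum_comm]
    refine sum_congr rfl fun b hb => ?_
    rw [proportionalPairs, card_filter, Nat.cast_sum, sum_product]
    refine sum_congr rfl fun m _ => sum_congr rfl fun n _ => ?_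
    have hiff : f (a, m) = f (b, n) ↔ (p : ℤ) ∣ a * n - b * m := by
      rw [← ZMod.intCast_eq_intCast_iff_dvd_sub]
      have ha0 := hane a ha
      have hb0 := hane b hb
      simp only [hf]
      push_cast
      rw [← div_eq_mul_inv, ← div_eq_mul_inv, div_eq_div_iff ha0 hb0, mul_comm, mul_comm (n : ZMod p)]
    by_cases h : (p : ℤ) ∣ a * n - b * m
    · rw [if_pos (hiff.2 h), if_pos h, Nat.cast_one]
    · rw [if_neg (mt hiff.1 h), if_neg h, Nat.cast_zero]
  have hcardI : (I.card : ℝ) = A * H := by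
    rw [hI, card_product, Int.card_Ioc, Nat.card_Icc, add_sub_cancel_left, Int.toNat_natCast,
      Nat.add_sub_cancel, Nat.cast_mul]
  rw [hsum]
  refine (sum_comp_pow_four_le I f w).trans ?_
  rw [hcoll, hcardI]
  have hm := sum_norm_pow_four_le hχ s
  rw [hscard] at hm
  have hv := sum_card_proportionalPairs_le hp N hH hA
  have h0 : 0 ≤ ∑ a ∈ Icc 1 A, ∑ b ∈ Icc 1 A, ((proportionalPairs p N H a b).card : ℝ) :=
    sum_nonneg fun _ _ => sum_nonneg fun _ _ => Nat.cast_nonneg _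
  exact mul_le_mul (mul_le_mul_of_nonneg_left hv (by positivity)) hm
    (sum_nonneg fun _ _ => by positivity) (mul_nonneg (by positivity) (h0.trans hv))

/-- The character sum over the interval `(N, N + H]`. -/
noncomputable def shortCharSum (χ : MulChar (ZMod p) ℂ) (N : ℤ) (H : ℕ) : ℂ :=
  ∑ n ∈ Ioc N (N + H), χ (n : ZMod p)

lemma norm_shortCharSum_le_length (χ : MulChar (ZMod p) ℂ) (N : ℤ) (H : ℕ) :
    ‖shortCharSum χ N H‖ ≤ H := by
  refine (norm_sum_le_of_le _ fun n _ => norm_mulChar_le_one χ _).trans ?_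
  simp

lemma shortCharSum_eq_add_shift (χ : MulChar (ZMod p) ℂ) (N : ℤ) (H h : ℕ) :
    shortCharSum χ N H = ∑ n ∈ Ioc N (N + H), χ ((n : ZMod p) + h) +
      (shortCharSum χ N h - shortCharSum χ (N + H) h) := by
  have hsplit : ∀ (M : ℤ) (u v : ℕ),
      shortCharSum χ M u + shortCharSum χ (M + u) v = ∑ n ∈ Ioc M (M + u + v), χ (n : ZMod p) := by
    intro M u v
    rw [shortCharSum, shortCharSum, ← sum_union]
    · rw [Ioc_union_Ioc_eq_Ioc (by omega) (by omega)]
    · exact Ioc_disjoint_Ioc_of_le le_rfl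
  have h1 := hsplit N H h
  have h2 := hsplit N h H
  rw [add_right_comm N (h : ℤ) (H : ℤ)] at h2
  have h3 : shortCharSum χ (N + h) H = ∑ n ∈ Ioc N (N + H), χ ((n : ZMod p) + h) := by
    rw [shortCharSum]
    symm
    refine sum_nbij' (· + (h : ℤ)) (· - (h : ℤ)) ?_ ?_ ?_ ?_ ?_
    · intro n hn; rw [mem_Ioc] at hn ⊢; omega
    · intro n hn; rw [mem_Ioc] at hn ⊢; omega
    · intro n _; simp
    · intro n _; simp
    · intro n _; simp
  rw [← h3]
  linear_combination h1 - h2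

lemma sum_sqrt_le (A : ℕ) : ∑ a ∈ Icc 1 A, √(a : ℝ) ≤ √A * (2 / 3 * A + 1 / 2) := by
  induction A with
  | zero => simp
  | succ A ih =>
    rw [sum_Icc_succ_top (by omega)]
    push_cast
    have hu : √(A : ℝ) ^ 2 = A := Real.sq_sqrt (by positivity)
    have hv : √((A : ℝ) + 1) ^ 2 = A + 1 := Real.sq_sqrt (by positivity)
    set u := √(A : ℝ)
    set v := √((A : ℝ) + 1)
    have hu0 : 0 ≤ u := Real.sqrt_nonneg _
    have hv0 : 0 < v := Real.sqrt_pos.2 (by positivity)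
    rw [← hv]
    rw [← hu] at ih hv
    have h1 : (v - u) * (v + u) = 1 := by linear_combination hv
    have huv : 0 < v - u := by
      by_contra h
      push Not at h
      nlinarith
    have h2 : v + u ≤ 4 / 3 * (v ^ 3 - u ^ 3) := by
      have h3 : v ^ 3 - u ^ 3 = (v - u) * (v ^ 2 + u * v + u ^ 2) := by ring
      have h4 : v + u = (v - u) * (v + u) * (v + u) := by rw [h1, one_mul]
      have h5 : 0 ≤ (v - u) * (v - u) ^ 2 := by positivity
      nlinarith
    nlinarith

/-- The recursive inequality behind Burgess' method. -/
lemma norm_shortCharSum_mul_le {χ : MulChar (ZMod p) ℂ} (N : ℤ) {H A B : ℕ} {D : ℝ}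
    (hD : ∀ h ≤ A * B, ∀ M, ‖shortCharSum χ M h‖ ≤ D * √h) :
    ‖shortCharSum χ N H‖ * (A * B) ≤
      ∑ a ∈ Icc 1 A, ∑ n ∈ Ioc N (N + H), ‖∑ b ∈ Icc 1 B, χ ((n : ZMod p) + a * b)‖ +
      2 * D * ((√A * (2 / 3 * A + 1 / 2)) * (√B * (2 / 3 * B + 1 / 2))) := by
  rcases Nat.eq_zero_or_pos (A * B) with h0 | h0
  · have h1 : (A : ℝ) * B = 0 := by exact_mod_cast h0
    have h2 : √(A : ℝ) * √B = 0 := by rw [← Real.sqrt_mul (by positivity), h1, Real.sqrt_zero]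
    have h3 : (√(A : ℝ) * (2 / 3 * A + 1 / 2)) * (√B * (2 / 3 * B + 1 / 2)) = 0 := by
      rw [mul_mul_mul_comm, h2, zero_mul]
    rw [h1, h3, mul_zero, mul_zero, add_zero]
    positivity
  have hD0 : 0 ≤ D := by
    have := (norm_nonneg _).trans (hD 1 h0 0)
    simpa using this
  have h1 : shortCharSum χ N H * (A * B) = ∑ a ∈ Icc 1 A, ∑ n ∈ Ioc N (N + H),
      ∑ b ∈ Icc 1 B, χ ((n : ZMod p) + a * b) +
      ∑ a ∈ Icc 1 A, ∑ b ∈ Icc 1 B,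
        (shortCharSum χ N (a * b) - shortCharSum χ (N + H) (a * b)) := by
    have h2 : shortCharSum χ N H * (A * B) =
        ∑ a ∈ Icc 1 A, ∑ b ∈ Icc 1 B, shortCharSum χ N H := by
      simp; ring
    rw [h2, ← sum_add_distrib]
    refine sum_congr rfl fun a _ => ?_
    rw [sum_comm, ← sum_add_distrib]
    refine sum_congr rfl fun b _ => ?_
    rw [shortCharSum_eq_add_shift χ N H (a * b)]
    push_cast
    rfl
  have h2 : ‖shortCharSum χ N H‖ * (A * B) = ‖shortCharSum χ N H * (A * B)‖ := by
    simp
  rw [h2, h1]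
  refine (norm_add_le _ _).trans (add_le_add ?_ ?_)
  · exact norm_sum_le_of_le _ fun a _ => norm_sum_le _ _
  · have h3 : ∀ a ∈ Icc 1 A, ∀ b ∈ Icc 1 B,
        ‖shortCharSum χ N (a * b) - shortCharSum χ (N + H) (a * b)‖ ≤ 2 * D * (√a * √b) := by
      intro a ha b hb
      rw [mem_Icc] at ha hb
      have hab : a * b ≤ A * B := Nat.mul_le_mul ha.2 hb.2
      have h4 := hD _ hab N
      have h5 := hD _ hab (N + H)
      rw [Nat.cast_mul, Real.sqrt_mul (by positivity)] at h4 h5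
      refine (norm_sub_le _ _).trans ?_
      linarith
    refine (norm_sum_le_of_le _ fun a ha => norm_sum_le_of_le _ fun b hb => h3 a ha b hb).trans ?_
    simp only [← mul_sum, ← sum_mul]
    have h4 := sum_sqrt_le A
    have h5 := sum_sqrt_le B
    gcongr

end Amplification

section Burgess

open Finset

/-- The estimate of the second moment of the number of representations in Burgess' method. -/
lemma burgess_moment_factor {p y l A H : ℝ} (hy0 : 0 < y) (hp : p = y ^ 16)
    (hlog : 40 ≤ Real.log p) (hl : l ^ 4 = Real.log p) (hA : 3400 ≤ A) (hAH : A ≤ 0.001 * H)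
    (hAy : A ≤ 0.2813 * y ^ 6) (hH0 : 0 < H) (hH2 : H ≤ 2 * y ^ 10) :
    A ^ 2 * (2 * H ^ 2 / p + 2 * A * H / p + 1) + 2 * H * A * (1 + Real.log A) ≤
      2 * (A * H) * (0.42 * l ^ 4) := by
  have hp0 : 0 < p := by rw [hp]; positivity
  have hA0 : 0 < A := by linarith
  have hlogA : Real.log A ≤ 3 / 8 * Real.log p := by
    have h1 : Real.log A ≤ Real.log (y ^ 6) := by
      apply Real.log_le_log hA0
      linarith [pow_pos hy0 6]
    rw [Real.log_pow] at h1
    rw [hp, Real.log_pow]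
    push_cast at h1 ⊢
    linarith
  have h1 : A * H / p ≤ 0.5627 := by
    rw [div_le_iff₀ hp0, hp]
    have : A * H ≤ 0.2813 * y ^ 6 * (2 * y ^ 10) := by gcongr
    have h2 : 0.2813 * y ^ 6 * (2 * y ^ 10) = 0.5626 * y ^ 16 := by ring
    linarith [pow_pos hy0 16]
  have hAA : A * A ≤ A * (0.001 * H) := mul_le_mul_of_nonneg_left hAH hA0.le
  have h2 : A * A / p ≤ 0.001 := by
    have h3 : A * A / p ≤ 0.001 * (A * H / p) := by
      rw [← mul_div_assoc]
      exact div_le_div_of_nonneg_right (by linarith) hp0.le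
    linarith
  have h3 : A ^ 2 * (2 * H ^ 2 / p + 2 * A * H / p + 1) + 2 * H * A * (1 + Real.log A) =
      2 * (A * H) * (A * H / p + A * A / p + 1 + Real.log A) + A * A := by ring
  have h5 : A * H / p + A * A / p + 1 + Real.log A + 0.001 ≤ 0.42 * l ^ 4 := by
    rw [hl]; linarith
  have h6 : 2 * (A * H) * (A * H / p + A * A / p + 1 + Real.log A + 0.001) ≤
      2 * (A * H) * (0.42 * l ^ 4) := mul_le_mul_of_nonneg_left h5 (by positivity)
  rw [h3]
  linarith [mul_pos hA0 hH0]

/-- The size estimate making Burgess' method work for the exponent `r = 2`. -/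
lemma burgess_parameters {p y l A B H : ℝ} (hy0 : 0 < y) (hy : 316 ≤ y ^ 2) (hp : p = y ^ 16)
    (hl0 : 0 < l) (hl : l ^ 4 = Real.log p) (hlog : 40 ≤ Real.log p) (hA0 : 0 ≤ A)
    (hB1 : B ≤ y ^ 4) (hB2 : y ^ 4 < B + 1) (hA1 : 64 * (A * B) ≤ 9 * H)
    (hA2 : 9 * H < 64 * ((A + 1) * B)) (hH1 : 12.78 * (y ^ 6 * l ^ 2) ≤ H)
    (hH2 : H ≤ 2 * y ^ 10) :
    3400 ≤ A ∧ 99855 ≤ B ∧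
    (A * H) ^ 2 * (A ^ 2 * (2 * H ^ 2 / p + 2 * A * H / p + 1) + 2 * H * A * (1 + Real.log A)) *
      (3 * B ^ 2 * p + B ^ 4 * (2 * √p + 1)) ≤
    (0.6665 * (3.5751 * (y ^ 3 * l) * √H) * (A * B)) ^ 4 := by
  have hy4 : 99856 ≤ y ^ 4 := by nlinarith
  have hB : 99855 ≤ B := by linarith
  have hl2 : 6.3 ≤ l ^ 2 := by
    by_contra h
    push Not at h
    nlinarith [sq_nonneg l]
  have hH0 : 0 < H := lt_of_lt_of_le (by positivity) hH1
  have hA : 3400 ≤ A := by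
    have h1 : 9 * (12.78 * (y ^ 6 * l ^ 2)) < 64 * ((A + 1) * y ^ 4) := by nlinarith
    have h2 : y ^ 4 * (9 * 12.78 * (y ^ 2 * l ^ 2)) < y ^ 4 * (64 * (A + 1)) := by
      linarith
    have h3 := lt_of_mul_lt_mul_left h2 (by positivity)
    have h4 : 316 * 6.3 ≤ y ^ 2 * l ^ 2 := mul_le_mul hy hl2 (by norm_num) (by positivity)
    linarith
  refine ⟨hA, hB, ?_⟩
  have hp0 : 0 < p := by rw [hp]; positivity
  have hsqrt : √p = y ^ 8 := by
    rw [hp, show y ^ 16 = (y ^ 8) ^ 2 by ring]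
    exact Real.sqrt_sq (by positivity)
  have hBy : y ^ 8 ≤ 1.00003 * B ^ 2 := by
    have h1 : y ^ 4 * (1 - 0.000011) ≤ B := by nlinarith
    have h2 : (y ^ 4 * (1 - 0.000011)) ^ 2 ≤ B ^ 2 := by gcongr
    nlinarith
  have hM : 3 * B ^ 2 * p + B ^ 4 * (2 * √p + 1) ≤ 5.0002 * (B ^ 4 * y ^ 8) := by
    have h1 : 3 * B ^ 2 * p ≤ 3.00009 * (B ^ 4 * y ^ 8) := by
      have : B ^ 2 * y ^ 8 * y ^ 8 ≤ B ^ 2 * y ^ 8 * (1.00003 * B ^ 2) := by gcongr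
      rw [hp]; nlinarith
    have h2 : B ^ 4 ≤ 0.0001 * (B ^ 4 * y ^ 8) := by
      have : 10000 ≤ y ^ 8 := by nlinarith
      nlinarith [pow_pos (lt_of_lt_of_le (by norm_num) hB) 4]
    rw [hsqrt, show B ^ 4 * (2 * y ^ 8 + 1) = 2 * (B ^ 4 * y ^ 8) + B ^ 4 by ring]
    linarith [show 0 ≤ B ^ 4 * y ^ 8 by positivity]
  have hHA : H ≤ 7.1134 * (A * B) := by nlinarith
  have hAy : A ≤ 0.2813 * y ^ 6 := by
    have h1 : 64 * (A * (y ^ 4 * (1 - 0.000011))) ≤ 18 * y ^ 10 := by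
      have : y ^ 4 * (1 - 0.000011) ≤ B := by nlinarith
      nlinarith
    have h2 : y ^ 4 * (64 * (1 - 0.000011) * A) ≤ y ^ 4 * (18 * y ^ 6) := by linarith
    have h3 := le_of_mul_le_mul_left h2 (by positivity)
    nlinarith [pow_pos hy0 6]
  have hAH : A ≤ 0.001 * H := by nlinarith
  have hV := burgess_moment_factor hy0 hp hlog hl hA hAH hAy hH0 hH2
  have hB0 : 0 < B := by linarith
  have hs : √H ^ 4 = H ^ 2 := by
    rw [show √H ^ 4 = (√H ^ 2) ^ 2 by ring, Real.sq_sqrt hH0.le]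
  have hM0 : 0 ≤ 3 * B ^ 2 * p + B ^ 4 * (2 * √p + 1) := by positivity
  have hexpand : (0.6665 * (3.5751 * (y ^ 3 * l) * √H) * (A * B)) ^ 4 =
      0.6665 ^ 4 * 3.5751 ^ 4 * (y ^ 12 * l ^ 4 * H ^ 2 * A ^ 4 * B ^ 4) := by
    rw [← hs]; ring
  calc _ ≤ (A * H) ^ 2 * (2 * (A * H) * (0.42 * l ^ 4)) * (5.0002 * (B ^ 4 * y ^ 8)) := by
        gcongr
    _ = 4.200168 * (A ^ 3 * H ^ 2 * l ^ 4 * B ^ 4 * y ^ 8) * H := by ring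
    _ ≤ 4.200168 * (A ^ 3 * H ^ 2 * l ^ 4 * B ^ 4 * y ^ 8) * (7.1134 * (A * y ^ 4)) := by
        gcongr
        refine hHA.trans ?_
        gcongr
    _ = 4.200168 * 7.1134 * (y ^ 12 * l ^ 4 * H ^ 2 * A ^ 4 * B ^ 4) := by ring
    _ ≤ 0.6665 ^ 4 * 3.5751 ^ 4 * (y ^ 12 * l ^ 4 * H ^ 2 * A ^ 4 * B ^ 4) := by
        apply mul_le_mul_of_nonneg_right (by norm_num)
        positivity
    _ = _ := hexpand.symm

/-- Burgess' bound with exponent `r = 2` and an explicit constant. -/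
theorem norm_shortCharSum_le {p : ℕ} [Fact p.Prime] (hp20 : 10 ^ 20 ≤ p)
    {χ : MulChar (ZMod p) ℂ} (hχ : χ ≠ 1) {y l : ℝ} (hy0 : 0 < y) (hy : (p : ℝ) = y ^ 16)
    (hl0 : 0 < l) (hl : l ^ 4 = Real.log p) (H : ℕ) :
    (H : ℝ) ≤ 2 * y ^ 10 → ∀ N : ℤ, ‖shortCharSum χ N H‖ ≤ 3.5751 * (y ^ 3 * l) * √H := by
  have hp20' : (10 : ℝ) ^ 20 ≤ p := by exact_mod_cast hp20
  have hy2 : 316 ≤ y ^ 2 := by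
    by_contra h
    push Not at h
    have : (y ^ 2) ^ 8 < 316 ^ 8 := by gcongr
    rw [← pow_mul, ← hy] at this
    norm_num at this hp20'
    linarith
  have hlog : 40 ≤ Real.log p := by
    rw [Real.le_log_iff_exp_le (by linarith)]
    refine le_trans ?_ hp20'
    have h1 : Real.exp 40 = Real.exp 1 ^ 40 := by rw [← Real.exp_nat_mul]; norm_num
    rw [h1]
    calc Real.exp 1 ^ 40 ≤ 3 ^ 40 := by
          gcongr
          exact Real.exp_one_lt_three.le
      _ ≤ 10 ^ 20 := by norm_num
  induction H using Nat.strong_induction_on with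
  | _ H ih =>
  intro hH N
  have hs : √(H : ℝ) ^ 2 = H := Real.sq_sqrt (by positivity)
  rcases lt_or_ge (H : ℝ) (12.78 * (y ^ 6 * l ^ 2)) with hsmall | hlarge
  · refine (norm_shortCharSum_le_length χ N H).trans ?_
    have h1 : √(H : ℝ) ≤ 3.5751 * (y ^ 3 * l) := by
      apply Real.sqrt_le_iff.2 ⟨by positivity, ?_⟩
      nlinarith [show 0 < y ^ 6 * l ^ 2 by positivity]
    nlinarith [Real.sqrt_nonneg (H : ℝ)]
  have hy4 : 99856 ≤ y ^ 4 := by nlinarith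
  have hHpos : 0 < H := by
    have : (0 : ℝ) < H := lt_of_lt_of_le (by positivity) hlarge
    exact_mod_cast this
  set B := ⌊y ^ 4⌋₊ with hB
  have hB1 : (B : ℝ) ≤ y ^ 4 := Nat.floor_le (by positivity)
  have hB2 : y ^ 4 < B + 1 := Nat.lt_floor_add_one _
  have hB0 : (0 : ℝ) < B := by linarith
  set A := ⌊9 * (H : ℝ) / (64 * B)⌋₊ with hA
  have hA1 : 64 * ((A : ℝ) * B) ≤ 9 * H := by
    have : (A : ℝ) ≤ 9 * (H : ℝ) / (64 * B) := Nat.floor_le (by positivity)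
    rw [le_div_iff₀ (by positivity)] at this
    linarith
  have hA2 : 9 * (H : ℝ) < 64 * (((A : ℝ) + 1) * B) := by
    have : 9 * (H : ℝ) / (64 * B) < A + 1 := Nat.lt_floor_add_one _
    rw [div_lt_iff₀ (by positivity)] at this
    linarith
  obtain ⟨hA3, hB3, hmain⟩ := burgess_parameters hy0 hy2 hy hl0 hl hlog (Nat.cast_nonneg A) hB1 hB2
    hA1 hA2 hlarge hH
  set D := 3.5751 * (y ^ 3 * l) with hD
  have hD0 : 0 < D := by positivity
  have hAp : A < p := by
    have h1 : (A : ℝ) < p := by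
      rw [hy]
      have h2 : 64 * ((A : ℝ) * 1) ≤ 64 * (A * B) := by gcongr; linarith
      have h3 : y ^ 10 ≤ y ^ 16 := pow_le_pow_right₀ (by nlinarith) (by norm_num)
      nlinarith [pow_pos hy0 10]
    exact_mod_cast h1
  have hBp : B < p := by
    have h1 : (B : ℝ) < p := by
      rw [hy]
      exact hB1.trans_lt (pow_lt_pow_right₀ (by nlinarith) (by norm_num))
    exact_mod_cast h1
  have hAB : A * B < H := by
    have : (A : ℝ) * B < H := by
      have : (0 : ℝ) < H := by exact_mod_cast hHpos
      linarith
    exact_mod_cast this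
  have hrec := norm_shortCharSum_mul_le (χ := χ) N (H := H) (A := A) (B := B) (D := D)
    fun h hh M => ih h (by omega) (le_trans (by exact_mod_cast (by omega : h ≤ H)) hH) M
  have hV := (sum_norm_shifted_pow_four_le hχ N hHpos hAp hBp).trans hmain
  have hA0 : (0 : ℝ) < A := by linarith
  have hV' := (pow_le_pow_iff_left₀
    (sum_nonneg fun _ _ => sum_nonneg fun _ _ => norm_nonneg _)
    (mul_nonneg (mul_nonneg (by norm_num) (mul_nonneg hD0.le (Real.sqrt_nonneg _)))
      (mul_nonneg hA0.le hB0.le)) (by norm_num)).1 hV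
  have herr : 2 * D * ((√A * (2 / 3 * A + 1 / 2)) * (√B * (2 / 3 * B + 1 / 2))) ≤
      0.3335 * (D * √H) * (A * B) := by
    have h1 : √(A : ℝ) * √B ≤ 3 / 8 * √H := by
      rw [← Real.sqrt_mul hA0.le]
      apply Real.sqrt_le_iff.2 ⟨by positivity, ?_⟩
      rw [mul_pow, hs]
      linarith
    have h2 : (2 / 3 * (A : ℝ) + 1 / 2) ≤ 0.66682 * A := by linarith
    have h3 : (2 / 3 * (B : ℝ) + 1 / 2) ≤ 0.66668 * B := by linarith
    calc _ = 2 * D * (√A * √B) * ((2 / 3 * A + 1 / 2) * (2 / 3 * B + 1 / 2)) := by ring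
      _ ≤ 2 * D * (3 / 8 * √H) * ((0.66682 * A) * (0.66668 * B)) := by gcongr
      _ ≤ _ := by
        have : 0 ≤ D * √H * (A * B) := by positivity
        linarith
  have hfin : ‖shortCharSum χ N H‖ * (A * B) ≤ D * √H * (A * B) := by
    linarith
  exact le_of_mul_le_mul_right hfin (by positivity)

end Burgess

section Sieve

open Finset

/-- A nonzero residue which is not a `q`-th power for any `q ∈ T`. -/
def IsPowFree {p : ℕ} (T : Finset ℕ) (x : ZMod p) : Prop :=
  x ≠ 0 ∧ ∀ q ∈ T, ¬ ∃ y, y ^ q = x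

lemma isPowFree_insert {p q : ℕ} {T : Finset ℕ} {x : ZMod p} :
    IsPowFree (insert q T) x ↔ (x ≠ 0 ∧ ¬ ∃ y, y ^ q = x) ∧ IsPowFree T x := by
  simp only [IsPowFree, forall_mem_insert]
  tauto

open Classical in
/-- The number of `n ∈ (N, N + H]` that are not `q`-th powers modulo `p` for any `q ∈ T`. -/
noncomputable def powFreeCount (p : ℕ) (T : Finset ℕ) (N : ℤ) (H : ℕ) : ℕ :=
  #{n ∈ Ioc N (N + H) | IsPowFree T ((n : ℤ) : ZMod p)}

/-- The union bound for the sieved counts. -/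
lemma powFreeCount_le_union_add_sum (p : ℕ) (T Q : Finset ℕ) (N : ℤ) (H : ℕ) :
    (powFreeCount p T N H : ℝ) ≤ powFreeCount p (T ∪ Q) N H +
      ∑ q ∈ Q, ((powFreeCount p T N H : ℝ) - powFreeCount p (insert q T) N H) := by
  classical
  simp only [powFreeCount, card_filter]
  push_cast
  simp only [← sum_sub_distrib]
  rw [sum_comm, ← sum_add_distrib]
  refine sum_le_sum fun n _ => ?_
  have hnonneg : ∀ q ∈ Q, (0 : ℝ) ≤ (if IsPowFree T ((n : ℤ) : ZMod p) then 1 else 0) -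
      (if IsPowFree (insert q T) ((n : ℤ) : ZMod p) then 1 else 0) := by
    intro q _
    rw [isPowFree_insert]
    split_ifs with h1 h2 <;> simp_all
  by_cases hT : IsPowFree T ((n : ℤ) : ZMod p)
  · by_cases hU : IsPowFree (T ∪ Q) ((n : ℤ) : ZMod p)
    · rw [if_pos hT, if_pos hU]
      have h1 := sum_nonneg hnonneg
      rw [if_pos hT] at h1
      linarith
    · obtain ⟨q, hqQ, hq⟩ : ∃ q ∈ Q, ∃ y, y ^ q = ((n : ℤ) : ZMod p) := by
        by_contra! h
        refine hU ⟨hT.1, fun q hq => ?_⟩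
        rcases mem_union.1 hq with hq | hq
        · exact hT.2 q hq
        · simpa using h q hq
      have h1 := single_le_sum hnonneg hqQ
      have h2 : ¬ IsPowFree (insert q T) ((n : ℤ) : ZMod p) :=
        fun h => h.2 q (mem_insert_self q T) hq
      rw [if_pos hT, if_neg h2] at h1
      rw [if_neg hU]
      simpa [hT] using h1
  · rw [if_neg hT]
    have h1 := sum_nonneg hnonneg
    rw [if_neg hT] at h1
    positivity

lemma length_le_powFreeCount_add_one {p : ℕ} (N : ℤ) {H : ℕ} (hH : H ≤ p) :
    H ≤ powFreeCount p ∅ N H + 1 := by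
  classical
  have h1 := card_filter_add_card_filter_not (s := Ioc N (N + H))
    (fun n : ℤ => IsPowFree ∅ ((n : ℤ) : ZMod p))
  have h2 : #{n ∈ Ioc N (N + H) | ¬ IsPowFree ∅ ((n : ℤ) : ZMod p)} ≤ 1 := by
    rw [card_le_one]
    intro a ha b hb
    simp only [mem_filter, mem_Ioc, IsPowFree, notMem_empty, false_imp_iff, implies_true, and_true,
      not_not, ZMod.intCast_zmod_eq_zero_iff_dvd] at ha hb
    obtain ⟨c, hc⟩ := dvd_sub ha.2 hb.2
    have h3 : |a - b| < p := by
      rw [abs_lt]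
      omega
    exact sub_eq_zero.1 (Int.eq_zero_of_abs_lt_dvd ⟨c, hc⟩ h3)
  rw [Int.card_Ioc, add_sub_cancel_left, Int.toNat_natCast] at h1
  rw [powFreeCount]
  omega

lemma isEFree_iff_isPowFree {p e : ℕ} (he : e ≠ 0) (x : ℤ) :
    IsEFree p e x ↔ IsPowFree e.primeFactors (x : ZMod p) := by
  have hsol (d : ℕ) : (∃ y : ℤ, Int.ModEq p x (y ^ d)) ↔ ∃ y : ZMod p, y ^ d = x := by
    constructor
    · rintro ⟨y, hy⟩
      refine ⟨y, ?_⟩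
      have := (ZMod.intCast_eq_intCast_iff _ _ _).2 hy
      rw [this]
      push_cast
      rfl
    · rintro ⟨y, hy⟩
      obtain ⟨z, rfl⟩ := ZMod.intCast_surjective y
      refine ⟨z, (ZMod.intCast_eq_intCast_iff _ _ _).1 ?_⟩
      rw [← hy]
      push_cast
      rfl
  rw [IsEFree, IsPowFree, ne_eq, ZMod.intCast_zmod_eq_zero_iff_dvd]
  refine and_congr_right fun _ => ?_
  simp only [hsol]
  constructor
  · intro h q hq
    exact h q (Nat.dvd_of_mem_primeFactors hq) (Nat.prime_of_mem_primeFactors hq).one_lt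
  · rintro h d hd hd1 ⟨y, hy⟩
    have hq := Nat.minFac_prime hd1.ne'
    refine h d.minFac (Nat.mem_primeFactors.2 ⟨hq, (Nat.minFac_dvd d).trans hd, he⟩)
      ⟨y ^ (d / d.minFac), ?_⟩
    rw [← pow_mul, Nat.div_mul_cancel (Nat.minFac_dvd d), hy]

lemma ncountEFree_eq_powFreeCount {p e : ℕ} (he : e ≠ 0) (N : ℤ) (H : ℕ) :
    NcountEFree p e N H = powFreeCount p e.primeFactors N H := by
  classical
  rw [NcountEFree, powFreeCount, ← Set.ncard_coe_finset]
  congr 1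
  ext x
  simp only [Set.mem_ofPred_eq, coe_filter, mem_Ioc, isEFree_iff_isPowFree he, Int.add_one_le_iff,
    and_assoc]

lemma mul_pow_ne_one_of_coprime {G : Type*} [CommGroup G] {q m j : ℕ} {a b : G}
    (ha : orderOf a = q) (hb : b ≠ 1) (hm : b ^ m = 1) (hmq : m.Coprime q) : b * a ^ j ≠ 1 := by
  intro h
  have h1 : b ^ q = 1 := by
    have h2 : (b * a ^ j) ^ q = b ^ q := by
      rw [mul_pow, ← pow_mul, mul_comm j q, pow_mul, ← ha, pow_orderOf_eq_one, one_pow, mul_one]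
    rw [← h2, h, one_pow]
  have h2 := pow_gcd_eq_one.2 ⟨hm, h1⟩
  rw [hmq.gcd_eq_one, pow_one] at h2
  exact hb h2

variable {p : ℕ} [Fact p.Prime]

lemma exists_pow_eq_of_mulChar_eq_one {q : ℕ} (hq : q.Prime) {χ : MulChar (ZMod p) ℂ}
    (hχ : orderOf χ = q) {x : ZMod p} (hx : χ x = 1) : ∃ y, y ^ q = x := by
  have hx0 : x ≠ 0 := by
    rintro rfl
    simp [χ.map_zero] at hx
  obtain ⟨g, hg⟩ := IsCyclic.exists_generator (α := (ZMod p)ˣ)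
  obtain ⟨k, hk⟩ := (mem_powers_iff_mem_zpowers.2 (hg (Units.mk0 x hx0)) :)
  have hk' : (g : ZMod p) ^ k = x := by
    simpa using congrArg Units.val hk
  by_cases hqk : q ∣ k
  · obtain ⟨m, rfl⟩ := hqk
    exact ⟨(g : ZMod p) ^ m, by rw [← hk', ← pow_mul, mul_comm]⟩
  exfalso
  have h1 : χ g ^ k = 1 := by rw [← map_pow, hk', hx]
  have h2 : χ g ^ q = 1 := by
    rw [← MulChar.pow_apply_coe, ← hχ, pow_orderOf_eq_one, MulChar.one_apply_coe]
  have h3 : χ g = 1 := by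
    have := pow_gcd_eq_one.2 ⟨h1, h2⟩
    rwa [Nat.Coprime.gcd_eq_one ((hq.coprime_iff_not_dvd.2 hqk).symm), pow_one] at this
  have h4 : χ = 1 := by
    apply MulChar.ext
    intro u
    obtain ⟨j, rfl⟩ := (mem_powers_iff_mem_zpowers.2 (hg u) :)
    simp [h3]
  rw [h4, orderOf_one] at hχ
  exact hq.one_lt.ne hχ

open Classical in
lemma sum_mulChar_pow_apply {q : ℕ} (hq : q.Prime) {χ : MulChar (ZMod p) ℂ}
    (hχ : orderOf χ = q) (x : ZMod p) :
    ∑ j ∈ range q, (χ ^ j) x = if x ≠ 0 ∧ ∃ y, y ^ q = x then (q : ℂ) else 0 := by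
  by_cases hx0 : x = 0
  · subst hx0
    simp [MulChar.map_zero]
  have hpow (j : ℕ) : (χ ^ j) x = χ x ^ j := by
    have := MulChar.pow_apply_coe χ j (Units.mk0 x hx0)
    simpa using this
  have hord : χ x ^ q = 1 := by
    rw [← hpow, ← hχ, pow_orderOf_eq_one, MulChar.one_apply (Ne.isUnit hx0)]
  simp only [hpow]
  split_ifs with h
  · obtain ⟨y, rfl⟩ := h.2
    have hy0 : y ≠ 0 := by
      rintro rfl
      exact hx0 (zero_pow hq.ne_zero)
    have h1 : χ (y ^ q) = 1 := by
      have := MulChar.pow_apply_coe χ q (Units.mk0 y hy0)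
      rw [map_pow]
      simp only [Units.val_mk0] at this
      rw [← this, ← hχ, pow_orderOf_eq_one, MulChar.one_apply (Ne.isUnit hy0)]
    simp [h1]
  · have h1 : χ x ≠ 1 := fun h1 => h ⟨hx0, exists_pow_eq_of_mulChar_eq_one hq hχ h1⟩
    rw [geom_sum_eq h1, hord, sub_self, zero_div]

lemma exists_mulChar_orderOf_eq_prime {q : ℕ} (hq : q.Prime) (hqp : q ∣ p - 1) :
    ∃ χ : MulChar (ZMod p) ℂ, orderOf χ = q :=
  MulChar.exists_mulChar_orderOf (ZMod p) (by rwa [ZMod.card])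
    (Complex.isPrimitiveRoot_exp q hq.ne_zero)

open Classical in
/-- The sum of a character over the `n ∈ (N, N + H]` that are not `q`-th powers modulo `p` for
any `q ∈ T`. -/
noncomputable def powFreeSum (ψ : MulChar (ZMod p) ℂ) (T : Finset ℕ) (N : ℤ) (H : ℕ) : ℂ :=
  ∑ n ∈ Ioc N (N + H), if IsPowFree T ((n : ℤ) : ZMod p) then ψ n else 0

lemma powFreeSum_one (T : Finset ℕ) (N : ℤ) (H : ℕ) :
    powFreeSum (1 : MulChar (ZMod p) ℂ) T N H = powFreeCount p T N H := by
  classical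
  rw [powFreeSum, powFreeCount, card_filter]
  push_cast
  refine sum_congr rfl fun n _ => ?_
  split_ifs with h
  · exact MulChar.one_apply (Ne.isUnit h.1)
  · rfl

lemma powFreeSum_empty (ψ : MulChar (ZMod p) ℂ) (N : ℤ) (H : ℕ) :
    powFreeSum ψ ∅ N H = shortCharSum ψ N H := by
  refine sum_congr rfl fun n _ => ?_
  by_cases h : ((n : ℤ) : ZMod p) = 0
  · simp [h, IsPowFree, MulChar.map_zero]
  · simp [h, IsPowFree]

lemma powFreeSum_insert {q : ℕ} (hq : q.Prime) {χ : MulChar (ZMod p) ℂ} (hχ : orderOf χ = q)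
    (ψ : MulChar (ZMod p) ℂ) (T : Finset ℕ) (N : ℤ) (H : ℕ) :
    powFreeSum ψ (insert q T) N H = (1 - 1 / (q : ℂ)) * powFreeSum ψ T N H -
      1 / (q : ℂ) * ∑ j ∈ Ico 1 q, powFreeSum (ψ * χ ^ j) T N H := by
  classical
  have hq0 : (q : ℂ) ≠ 0 := by exact_mod_cast hq.ne_zero
  have key : powFreeSum ψ (insert q T) N H = powFreeSum ψ T N H -
      1 / (q : ℂ) * ∑ j ∈ range q, powFreeSum (ψ * χ ^ j) T N H := by
    simp only [powFreeSum]
    rw [sum_comm, mul_sum, ← sum_sub_distrib]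
    refine sum_congr rfl fun n _ => ?_
    rw [isPowFree_insert]
    by_cases hT : IsPowFree T ((n : ℤ) : ZMod p)
    · simp only [hT, and_true, if_true, MulChar.mul_apply, ← mul_sum]
      rw [sum_mulChar_pow_apply hq hχ]
      by_cases h : ∃ y, y ^ q = ((n : ℤ) : ZMod p)
      · simp only [h]
        simp only [hT.1, ne_eq, not_false_eq_true, not_true_eq_false, and_false, and_true, if_true,
          if_false]
        field_simp
        ring
      · simp [h, hT.1]
    · simp [hT]
  rw [key, ← Nat.Ico_zero_eq_range, sum_eq_sum_Ico_succ_bot hq.pos]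
  simp only [pow_zero, mul_one, zero_add]
  ring

/-- The proportion of residues that are no `q`-th powers, `q ∈ T`. -/
noncomputable def powFreeDensity (T : Finset ℕ) : ℝ := ∏ q ∈ T, (1 - 1 / (q : ℝ))

lemma one_sub_one_div_prime_pos {q : ℕ} (hq : q.Prime) : 0 < 1 - 1 / (q : ℝ) := by
  rw [sub_pos, div_lt_one (by exact_mod_cast hq.pos)]
  exact_mod_cast hq.one_lt

lemma powFreeDensity_pos {T : Finset ℕ} (hT : ∀ q ∈ T, q.Prime) : 0 < powFreeDensity T :=
  prod_pos fun q hq => one_sub_one_div_prime_pos (hT q hq)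

lemma norm_one_sub_one_div_prime {q : ℕ} (hq : q.Prime) :
    ‖(1 - 1 / (q : ℂ))‖ = 1 - 1 / (q : ℝ) := by
  rw [show (1 - 1 / (q : ℂ)) = ((1 - 1 / (q : ℝ) : ℝ) : ℂ) by push_cast; rfl,
    Complex.norm_of_nonneg (one_sub_one_div_prime_pos hq).le]

lemma norm_one_div_mul_sum_Ico_le {q : ℕ} (hq : q.Prime) {f : ℕ → ℂ} {C : ℝ}
    (hf : ∀ j ∈ Ico 1 q, ‖f j‖ ≤ C) :
    ‖1 / (q : ℂ) * ∑ j ∈ Ico 1 q, f j‖ ≤ (1 - 1 / (q : ℝ)) * C := by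
  have hq0 : (0 : ℝ) < q := by exact_mod_cast hq.pos
  rw [norm_mul, norm_div, norm_one, Complex.norm_natCast]
  have h1 : ‖∑ j ∈ Ico 1 q, f j‖ ≤ ((q : ℝ) - 1) * C := by
    refine (norm_sum_le_of_le _ hf).trans_eq ?_
    rw [sum_const, Nat.card_Ico, nsmul_eq_mul, Nat.cast_sub hq.pos, Nat.cast_one]
  calc _ ≤ 1 / (q : ℝ) * (((q : ℝ) - 1) * C) := by gcongr
    _ = _ := by field_simp

/-- The sieved sum of a nontrivial character whose order is coprime to the sifting primes. -/
lemma norm_powFreeSum_le {N : ℤ} {H : ℕ} {E : ℝ}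
    (hE : ∀ χ : MulChar (ZMod p) ℂ, χ ≠ 1 → ‖shortCharSum χ N H‖ ≤ E) {T : Finset ℕ}
    (hT : ∀ q ∈ T, q.Prime) (hTp : ∀ q ∈ T, q ∣ p - 1) {ψ : MulChar (ZMod p) ℂ} (hψ : ψ ≠ 1)
    {m : ℕ} (hm : ψ ^ m = 1) (hmT : ∀ q ∈ T, m.Coprime q) :
    ‖powFreeSum ψ T N H‖ ≤ powFreeDensity T * (2 ^ #T * E) := by
  induction T using Finset.induction_on generalizing ψ m with
  | empty => simpa [powFreeSum_empty, powFreeDensity] using hE ψ hψ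
  | insert q T hqT ih =>
    simp only [forall_mem_insert] at hT hTp hmT
    obtain ⟨χ, hχ⟩ := exists_mulChar_orderOf_eq_prime hT.1 hTp.1
    rw [powFreeSum_insert hT.1 hχ]
    have h1 := ih hT.2 hTp.2 hψ hm hmT.2
    have h2 : ∀ j ∈ Ico 1 q, ‖powFreeSum (ψ * χ ^ j) T N H‖ ≤ powFreeDensity T * (2 ^ #T * E) := by
      intro j _
      refine ih (m := m * q) hT.2 hTp.2 (mul_pow_ne_one_of_coprime hχ hψ hm hmT.1) ?_ ?_
      · rw [mul_pow, pow_mul, hm, one_pow, one_mul, ← pow_mul, mul_comm j, mul_assoc,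
          mul_comm m, mul_assoc, pow_mul, ← hχ, pow_orderOf_eq_one, one_pow]
      · intro r hr
        refine Nat.Coprime.mul_left (hmT.2 r hr) ((Nat.coprime_primes hT.1 (hT.2 r hr)).2 ?_)
        rintro rfl
        exact hqT hr
    refine (norm_sub_le _ _).trans ?_
    rw [norm_mul, norm_one_sub_one_div_prime hT.1, powFreeDensity, prod_insert hqT,
      card_insert_of_notMem hqT, ← powFreeDensity]
    have h3 := norm_one_div_mul_sum_Ico_le hT.1 h2
    have h4 := mul_le_mul_of_nonneg_left h1 (one_sub_one_div_prime_pos hT.1).le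
    rw [pow_succ]
    linarith

/-- The effect on the sieved count of adjoining one sifting prime. -/
lemma abs_powFreeCount_insert_sub_le {N : ℤ} {H : ℕ} {E : ℝ}
    (hE : ∀ χ : MulChar (ZMod p) ℂ, χ ≠ 1 → ‖shortCharSum χ N H‖ ≤ E) {T : Finset ℕ}
    (hT : ∀ q ∈ T, q.Prime) (hTp : ∀ q ∈ T, q ∣ p - 1) {q : ℕ} (hq : q.Prime) (hqp : q ∣ p - 1)
    (hqT : q ∉ T) :
    |(powFreeCount p (insert q T) N H : ℝ) - (1 - 1 / (q : ℝ)) * powFreeCount p T N H| ≤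
      (1 - 1 / (q : ℝ)) * (powFreeDensity T * (2 ^ #T * E)) := by
  obtain ⟨χ, hχ⟩ := exists_mulChar_orderOf_eq_prime hq hqp
  have h1 := powFreeSum_insert hq hχ 1 T N H
  rw [powFreeSum_one, powFreeSum_one] at h1
  have h2 : ∀ j ∈ Ico 1 q,
      ‖powFreeSum (1 * χ ^ j) T N H‖ ≤ powFreeDensity T * (2 ^ #T * E) := by
    intro j hj
    rw [mem_Ico] at hj
    rw [one_mul]
    refine norm_powFreeSum_le hE hT hTp (m := q) ?_ ?_ ?_
    · rw [← hχ] at hj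
      exact pow_ne_one_of_lt_orderOf (by omega) hj.2
    · rw [← pow_mul, mul_comm, pow_mul, ← hχ, pow_orderOf_eq_one, one_pow]
    · intro r hr
      refine (Nat.coprime_primes hq (hT r hr)).2 ?_
      rintro rfl
      exact hqT hr
  have h3 := norm_one_div_mul_sum_Ico_le hq h2
  have h4 : ((((powFreeCount p (insert q T) N H : ℝ) -
      (1 - 1 / (q : ℝ)) * powFreeCount p T N H : ℝ)) : ℂ) =
      -(1 / (q : ℂ) * ∑ j ∈ Ico 1 q, powFreeSum (1 * χ ^ j) T N H) := by
    push_cast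
    rw [h1]
    ring
  rwa [← Real.norm_eq_abs, ← Complex.norm_real, h4, norm_neg]

lemma abs_powFreeCount_sub_le {N : ℤ} {H : ℕ} {E : ℝ}
    (hE : ∀ χ : MulChar (ZMod p) ℂ, χ ≠ 1 → ‖shortCharSum χ N H‖ ≤ E) {T : Finset ℕ}
    (hT : ∀ q ∈ T, q.Prime) (hTp : ∀ q ∈ T, q ∣ p - 1) :
    |(powFreeCount p T N H : ℝ) - powFreeDensity T * powFreeCount p ∅ N H| ≤
      powFreeDensity T * ((2 ^ #T - 1) * E) := by
  induction T using Finset.induction_on with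
  | empty => simp [powFreeDensity]
  | insert q T hqT ih =>
    simp only [forall_mem_insert] at hT hTp
    have h1 := ih hT.2 hTp.2
    have h2 := abs_powFreeCount_insert_sub_le hE hT.2 hTp.2 hT.1 hTp.1 hqT
    have h0 := one_sub_one_div_prime_pos hT.1
    have h3 := mul_le_mul_of_nonneg_left h1 h0.le
    rw [← abs_of_pos h0, ← abs_mul, abs_of_pos h0] at h3
    rw [powFreeDensity, prod_insert hqT, card_insert_of_notMem hqT, ← powFreeDensity, pow_succ]
    rw [abs_le] at *
    constructor <;> linarith [h2.1, h2.2, h3.1, h3.2]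

/-- The sieve inequality, given a bound `E` for the nontrivial character sums. -/
lemma sieve_lower_bound {N : ℤ} {H : ℕ} {E : ℝ} (hHp : H ≤ p) (hE1 : 1 ≤ E)
    (hE : ∀ χ : MulChar (ZMod p) ℂ, χ ≠ 1 → ‖shortCharSum χ N H‖ ≤ E) {T Q : Finset ℕ}
    (hT : ∀ q ∈ T, q.Prime) (hTp : ∀ q ∈ T, q ∣ p - 1) (hQ : ∀ q ∈ Q, q.Prime)
    (hQp : ∀ q ∈ Q, q ∣ p - 1) (hTQ : ∀ q ∈ Q, q ∉ T) {δ : ℝ}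
    (hδ : δ = 1 - ∑ q ∈ Q, 1 / (q : ℝ)) (hδ0 : 0 < δ) :
    δ * powFreeDensity T * (H - 2 ^ #T * E * (((#Q : ℝ) - 1) / δ + 2)) ≤
      powFreeCount p (T ∪ Q) N H := by
  set K : ℝ := (powFreeCount p T N H : ℝ) with hK
  set D := powFreeDensity T with hD
  have hD0 : 0 < D := powFreeDensity_pos hT
  have h1 := powFreeCount_le_union_add_sum p T Q N H
  have h2 : ∑ q ∈ Q, (K - powFreeCount p (insert q T) N H) ≤
      ∑ q ∈ Q, (1 / (q : ℝ) * K + (1 - 1 / (q : ℝ)) * (D * (2 ^ #T * E))) := by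
    refine sum_le_sum fun q hq => ?_
    have := (abs_le.1 (abs_powFreeCount_insert_sub_le hE hT hTp (hQ q hq) (hQp q hq)
      (hTQ q hq))).1
    linarith
  have h8 : ∑ q ∈ Q, (1 - 1 / (q : ℝ)) = #Q - (1 - δ) := by
    rw [sum_sub_distrib, sum_const, nsmul_eq_mul, mul_one, hδ, sub_sub_cancel]
  rw [sum_add_distrib, ← sum_mul, ← sum_mul, h8,
    show ∑ q ∈ Q, 1 / (q : ℝ) = 1 - δ by rw [hδ]; ring] at h2
  have h3 := (abs_le.1 (abs_powFreeCount_sub_le hE hT hTp (N := N) (H := H))).1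
  have h4 : (H : ℝ) ≤ powFreeCount p ∅ N H + 1 := by
    exact_mod_cast length_le_powFreeCount_add_one N hHp
  have h5 : D * ((H : ℝ) - 2 ^ #T * E) ≤ K := by
    have : D * ((H : ℝ) - E) ≤ D * powFreeCount p ∅ N H :=
      mul_le_mul_of_nonneg_left (by linarith) hD0.le
    linarith
  have h6 := mul_le_mul_of_nonneg_left h5 hδ0.le
  have h7 : δ * D * (H - 2 ^ #T * E * (((#Q : ℝ) - 1) / δ + 2)) =
      δ * (D * (H - 2 ^ #T * E)) - ((#Q : ℝ) - (1 - δ)) * (D * (2 ^ #T * E)) := by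
    field_simp
    ring
  linarith

end Sieve

theorem sieved_count_lower_bound (p : ℕ) (hp : p.Prime) (hp20 : 10 ^ 20 ≤ p)
    (e : ℕ) (he : Even e) (hed : e ∣ p - 1)
    (s : ℕ) (P : Fin s → ℕ)
    (hPinj : Function.Injective P)
    (hPprime : ∀ i, (P i).Prime)
    (hPdvd : ∀ i, P i ∣ p - 1)
    (hPnotdvd : ∀ i, ¬ P i ∣ e)
    (hPall : ∀ q : ℕ, q.Prime → q ∣ p - 1 → ¬ q ∣ e → ∃ i, P i = q)
    (δ : ℝ) (hδ : δ = 1 - ∑ i, (1 : ℝ) / (P i)) (hδpos : 0 < δ)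
    (N H : ℤ) (hH1 : 1 ≤ H) (hH2 : (H : ℝ) ≤ 2 * (p : ℝ) ^ ((5 : ℝ) / 8)) :
    (NcountEFree p (p - 1) N H : ℝ) ≥
      δ * ((Nat.totient e : ℝ) / (e : ℝ)) *
        ((H : ℝ) - (2 : ℝ) ^ e.primeFactors.card * 3.5751 * (H : ℝ) ^ ((1 : ℝ) / 2) *
          (p : ℝ) ^ ((3 : ℝ) / 16) * (Real.log p) ^ ((1 : ℝ) / 4) *
          (((s : ℝ) - 1) / δ + 2)) := by
  have : Fact p.Prime := ⟨hp⟩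
  have hp20' : (10 : ℝ) ^ 20 ≤ p := by exact_mod_cast hp20
  have hp0 : (0 : ℝ) < p := by linarith
  have hp1 : p - 1 ≠ 0 := by omega
  have he0 : e ≠ 0 := by
    rintro rfl
    exact hp1 (zero_dvd_iff.1 hed)
  lift H to ℕ using by omega
  have hlog : 1 ≤ Real.log p := by
    rw [Real.le_log_iff_exp_le hp0]
    linarith [Real.exp_one_lt_three]
  set y : ℝ := (p : ℝ) ^ ((1 : ℝ) / 16) with hy
  set l : ℝ := Real.log p ^ ((1 : ℝ) / 4) with hl
  have hy0 : 0 < y := Real.rpow_pos_of_pos hp0 _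
  have hpow (k : ℕ) : y ^ k = (p : ℝ) ^ ((k : ℝ) / 16) := by
    rw [hy, ← Real.rpow_natCast, ← Real.rpow_mul hp0.le]
    congr 1
    ring
  have hy1 : 1 ≤ y := Real.one_le_rpow (by linarith) (by norm_num)
  have hl1 : 1 ≤ l := Real.one_le_rpow hlog (by norm_num)
  have hyp : (p : ℝ) = y ^ 16 := by
    rw [hpow]
    norm_num
  have hl4 : l ^ 4 = Real.log p := by
    rw [hl, ← Real.rpow_natCast, ← Real.rpow_mul (by linarith)]
    norm_num
  have hHy : (H : ℝ) ≤ 2 * y ^ 10 := by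
    rw [hpow]
    push_cast at hH2 ⊢
    convert hH2 using 3
    norm_num
  have hH1' : (1 : ℝ) ≤ H := by exact_mod_cast hH1
  have hHp : H ≤ p := by
    have h1 : (H : ℝ) ≤ p := by
      have h2 : 2 ≤ y ^ 6 := by
        by_contra! h
        have h3 : (y ^ 6) ^ 3 < 2 ^ 3 := by gcongr
        have h4 : y ^ 16 ≤ y ^ 18 := pow_le_pow_right₀ hy1 (by norm_num)
        rw [← pow_mul] at h3
        norm_num at h3
        linarith
      have h3 : 2 * y ^ 10 ≤ y ^ 6 * y ^ 10 := by gcongr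
      rw [hyp]
      linarith
    exact_mod_cast h1
  set E : ℝ := 3.5751 * (y ^ 3 * l) * √H with hE
  have hE1 : 1 ≤ E := by
    have h1 : 1 ≤ √(H : ℝ) := Real.one_le_sqrt.2 hH1'
    have h2 : 1 ≤ y ^ 3 := one_le_pow₀ hy1
    calc (1 : ℝ) = 1 * (1 * 1) * 1 := by norm_num
      _ ≤ E := by rw [hE]; gcongr; norm_num
  have hbound (χ : MulChar (ZMod p) ℂ) (hχ : χ ≠ 1) : ‖shortCharSum χ N H‖ ≤ E :=
    norm_shortCharSum_le hp20 hχ hy0 hyp (by linarith) hl4 H hHy N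
  have hPimage : (p - 1).primeFactors = e.primeFactors ∪ Finset.univ.image P := by
    ext q
    simp only [Nat.mem_primeFactors, Finset.mem_union, Finset.mem_image, Finset.mem_univ, true_and]
    constructor
    · rintro ⟨hq, hqp, -⟩
      by_cases hqe : q ∣ e
      · exact Or.inl ⟨hq, hqe, he0⟩
      · exact Or.inr (hPall q hq hqp hqe)
    · rintro (⟨hq, hqe, -⟩ | ⟨i, rfl⟩)
      · exact ⟨hq, hqe.trans hed, hp1⟩
      · exact ⟨hPprime i, hPdvd i, hp1⟩
  have hdensity : (Nat.totient e : ℝ) / e = powFreeDensity e.primeFactors := by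
    have h1 := Nat.totient_eq_mul_prod_factors e
    have h2 : (Nat.totient e : ℝ) = e * ∏ q ∈ e.primeFactors, (1 - (q : ℝ)⁻¹) := by
      have h2 := congrArg (fun r : ℚ => (r : ℝ)) h1
      push_cast at h2
      exact h2
    rw [h2, mul_div_cancel_left₀ _ (by exact_mod_cast he0), powFreeDensity]
    simp only [one_div]
  have hmain := sieve_lower_bound (N := N) hHp hE1 hbound (T := e.primeFactors)
    (Q := Finset.univ.image P) (fun q hq => Nat.prime_of_mem_primeFactors hq)
    (fun q hq => (Nat.dvd_of_mem_primeFactors hq).trans hed)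
    (by simpa using hPprime) (by simpa using hPdvd)
    (by simpa using fun i _ h => absurd h (hPnotdvd i)) (δ := δ)
    (by rw [hδ, Finset.sum_image hPinj.injOn]) hδpos
  rw [Finset.card_image_of_injective _ hPinj, Finset.card_univ, Fintype.card_fin] at hmain
  rw [ge_iff_le, ncountEFree_eq_powFreeCount hp1, hPimage, hdensity]
  refine le_of_eq_of_le ?_ hmain
  have hy3 : (p : ℝ) ^ ((3 : ℝ) / 16) = y ^ 3 := by
    rw [hpow]
    norm_num
  rw [hy3, hE, Real.sqrt_eq_rpow, Int.cast_natCast]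
  ring
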